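/- arXiv:2511.19698 — 3 statements merged into one kernel-verified Lean document; each statement's English description precedes it below -/
import Mathlib

section
/- For all positive integers n and k, the number of partitions of n with even mex and exactly k parts greater than 1 equals the number of partitions of n with a fixed point and exactly k+1 parts greater than 1, equals the number of partitions of n with negative crank and exactly k parts greater than 1, and equals the number of partitions of n with positive crank and exactly k+1 parts greater than 1. -/
open scoped Classical

/-- The parts of a partition, sorted in nonincreasing order, so that
`(sortedParts p).getD (i-1) 0` is the `i`-th part `λ_i` (1-indexed). -/
def sortedParts {n : ℕ} (p : n.Partition) : List ℕ :=
  p.parts.sort (· ≥ ·)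

/-- The mex of a partition: the smallest positive integer that is not a part. -/
noncomputable def mex {n : ℕ} (p : n.Partition) : ℕ :=
  sInf {m : ℕ | 0 < m ∧ m ∉ p.parts}

/-- A partition has a fixed point if `λ_i = i` for some index `i`. -/
def hasFixedPoint {n : ℕ} (p : n.Partition) : Prop :=
  ∃ i : ℕ, 0 < i ∧ i ≤ (sortedParts p).length ∧ (sortedParts p).getD (i - 1) 0 = i

/-- `ω(λ)`: the number of parts equal to 1. -/
def omegaStat {n : ℕ} (p : n.Partition) : ℕ := p.parts.count 1

/-- `μ(λ)`: the number of parts greater than `ω(λ)`. -/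
def muStat {n : ℕ} (p : n.Partition) : ℕ :=
  (p.parts.filter (fun x => omegaStat p < x)).card

/-- The crank of a partition. -/
def crank {n : ℕ} (p : n.Partition) : ℤ :=
  if omegaStat p = 0 then (p.parts.sup : ℤ) else (muStat p : ℤ) - (omegaStat p : ℤ)

/-- `β(λ)`: the number of parts greater than 1. -/
def betaStat {n : ℕ} (p : n.Partition) : ℕ :=
  (p.parts.filter (fun x => 1 < x)).card

/-- The Durfee square size: the largest `i` with `λ_i ≥ i` (0 if none). -/
noncomputable def durfee {n : ℕ} (p : n.Partition) : ℕ :=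
  sSup {i : ℕ | 0 < i ∧ i ≤ (sortedParts p).length ∧ i ≤ (sortedParts p).getD (i - 1) 0}


def SS (n k : ℕ) : Set (ℕ × (ℕ → ℕ)) :=
  {x | Antitone x.2 ∧ (∀ m, m < k ↔ 0 < x.2 m) ∧ x.1 + ∑ m ∈ Finset.range k, x.2 m + k = n}

theorem ncard_rel {α β : Type*} (S : Set α) (T : Set β) (R : α → β → Prop)
    (h1 : ∀ x ∈ S, ∃ y ∈ T, R x y) (h2 : ∀ y ∈ T, ∃ x ∈ S, R x y)
    (h3 : ∀ x ∈ S, ∀ y ∈ T, ∀ y' ∈ T, R x y → R x y' → y = y')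
    (h4 : ∀ x ∈ S, ∀ x' ∈ S, ∀ y ∈ T, R x y → R x' y → x = x') : S.ncard = T.ncard := by
  choose f hf hR using h1
  refine Set.ncard_congr f hf ?_ ?_
  · intro a b ha hb h
    refine h4 a ha b hb (f a ha) (hf a ha) (hR a ha) ?_
    rw [h]; exact hR b hb
  · intro y hy
    obtain ⟨x, hx, hxy⟩ := h2 y hy
    exact ⟨x, hx, h3 x hx _ (hf x hx) _ hy (hR x hx) hxy⟩

def delR (i : ℕ) (f : ℕ → ℕ) : ℕ → ℕ := fun m => if m < i then f m else f (m + 1)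
def insR (i v : ℕ) (g : ℕ → ℕ) : ℕ → ℕ :=
  fun m => if m < i then g m else if m = i then v else g (m - 1)
def addR (i : ℕ) (f : ℕ → ℕ) : ℕ → ℕ := fun m => if m < i then f m + 1 else f m
def subR (i : ℕ) (f : ℕ → ℕ) : ℕ → ℕ := fun m => if m < i then f m - 1 else f m

theorem del_ins (i v : ℕ) (g : ℕ → ℕ) : delR i (insR i v g) = g := by
  funext m; simp only [delR, insR]; grind
theorem ins_del (i : ℕ) (f : ℕ → ℕ) : insR i (f i) (delR i f) = f := by
  funext m; simp only [delR, insR]; grind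
theorem ins_at (i v : ℕ) (g : ℕ → ℕ) : insR i v g i = v := by simp [insR]

theorem sum_del (f : ℕ → ℕ) (i k : ℕ) (h : i ≤ k) :
    ∑ m ∈ Finset.range k, delR i f m + f i = ∑ m ∈ Finset.range (k + 1), f m := by
  induction k, h using Nat.le_induction with
  | base =>
    rw [Finset.sum_range_succ]; congr 1
    refine Finset.sum_congr rfl fun m hm => ?_
    simp at hm; simp [delR, hm]
  | succ k hk ih =>
    rw [Finset.sum_range_succ, Finset.sum_range_succ (n := k + 1), ← ih]
    have : delR i f k = f (k + 1) := by simp [delR]; omega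
    omega

theorem sum_add (f : ℕ → ℕ) (i k : ℕ) (h : i ≤ k) :
    ∑ m ∈ Finset.range k, addR i f m = ∑ m ∈ Finset.range k, f m + i := by
  have : ∀ m, addR i f m = f m + if m < i then 1 else 0 := by intro m; simp only [addR]; grind
  simp only [this, Finset.sum_add_distrib]
  congr 1
  rw [← Finset.sum_filter]
  simp
  have : Finset.filter (fun a => a < i) (Finset.range k) = Finset.range i := by ext; simp; omega
  rw [this]; simp

theorem addR_subR (i : ℕ) (f : ℕ → ℕ) (h : ∀ m < i, 0 < f m) : addR i (subR i f) = f := by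
  funext m; simp only [addR, subR]; grind
theorem subR_addR (i : ℕ) (f : ℕ → ℕ) : subR i (addR i f) = f := by
  funext m; simp only [addR, subR]; grind

theorem SS_del {n k w i : ℕ} {f : ℕ → ℕ} (h : (w, f) ∈ SS n (k + 1)) (hi : i ≤ k) :
    Antitone (delR i f) ∧ (∀ m, m < k ↔ 0 < delR i f m) ∧
      w + (∑ m ∈ Finset.range k, delR i f m + f i) + (k + 1) = n := by
  obtain ⟨h1, h2, h3⟩ := h
  dsimp only at h1 h2 h3
  refine ⟨antitone_nat_of_succ_le fun m => ?_, fun m => ?_, ?_⟩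
  · have := h1 (Nat.le_succ m); have := h1 (Nat.le_succ (m+1))
    simp only [delR, Nat.succ_eq_add_one] at *; grind
  · have := h2 m; have := h2 (m + 1)
    simp only [delR]; grind
  · rw [sum_del f i k hi]; omega

theorem ins_props {k i v : ℕ} {g : ℕ → ℕ} (h1 : Antitone g) (h2 : ∀ m, m < k ↔ 0 < g m)
    (hi : i ≤ k) (hv : 0 < v) (ha : ∀ m < i, v ≤ g m) (hb : g i ≤ v) :
    Antitone (insR i v g) ∧ (∀ m, m < k + 1 ↔ 0 < insR i v g m) ∧
      ∑ m ∈ Finset.range (k + 1), insR i v g m = ∑ m ∈ Finset.range k, g m + v := by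
  refine ⟨antitone_nat_of_succ_le fun m => ?_, fun m => ?_, ?_⟩
  · have h3 := h1 (Nat.le_succ m); have h4 := h1 (Nat.le_succ (m-1)); have := ha m
    simp only [insR, Nat.succ_eq_add_one] at *
    rcases lt_trichotomy m i with h | h | h
    · by_cases h' : m + 1 < i
      · simp [h, h', h3]
      · have : m + 1 = i := by omega
        simp [h, this]; omega
    · subst h; simp; omega
    · have e : m - 1 + 1 = m := by omega
      rw [e] at h4
      simp [show ¬ m + 1 < i by omega, show ¬ m < i by omega, show ¬ m + 1 = i by omega,
        show ¬ m = i by omega, h4]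
  · have := h2 m; have := h2 (m - 1)
    simp only [insR]; grind
  · rw [← sum_del _ i k hi, del_ins, ins_at]

/-- combined: delete row i and add one to the rows above -/
def hR (i : ℕ) (f : ℕ → ℕ) : ℕ → ℕ := addR i (delR i f)
def uR (i v : ℕ) (g : ℕ → ℕ) : ℕ → ℕ := insR i v (subR i g)

theorem hR_lt {i m : ℕ} (f : ℕ → ℕ) (h : m < i) : hR i f m = f m + 1 := by simp [hR, addR, delR, h]
theorem hR_ge {i m : ℕ} (f : ℕ → ℕ) (h : i ≤ m) : hR i f m = f (m + 1) := by
  simp [hR, addR, delR, show ¬ m < i by omega]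
theorem uR_at (i v : ℕ) (g : ℕ → ℕ) : uR i v g i = v := ins_at _ _ _
theorem hu (i v : ℕ) (g : ℕ → ℕ) (h : ∀ m < i, 0 < g m) : hR i (uR i v g) = g := by
  rw [hR, uR, del_ins, addR_subR i g h]
theorem uh (i : ℕ) (f : ℕ → ℕ) : uR i (f i) (hR i f) = f := by
  rw [hR, uR, subR_addR, ins_del]

theorem SS_h {n k w i : ℕ} {f : ℕ → ℕ} (h : (w, f) ∈ SS n (k + 1)) (hi : i ≤ k) :
    Antitone (hR i f) ∧ (∀ m, m < k ↔ 0 < hR i f m) ∧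
      w + ∑ m ∈ Finset.range k, hR i f m + f i + (k + 1) = n + i := by
  obtain ⟨h1, h2, h3⟩ := SS_del h hi
  refine ⟨antitone_nat_of_succ_le fun m => ?_, fun m => ?_, ?_⟩
  · have := h1 (Nat.le_succ m)
    simp only [hR, addR, Nat.succ_eq_add_one] at *; grind
  · have := h2 m
    simp only [hR, addR]; grind
  · rw [hR, sum_add _ _ _ hi]; omega

theorem u_props {k i v : ℕ} {g : ℕ → ℕ} (h1 : Antitone g) (h2 : ∀ m, m < k ↔ 0 < g m)
    (hi : i ≤ k) (hv : 0 < v) (ha : ∀ m < i, v + 1 ≤ g m) (hb : g i ≤ v) :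
    Antitone (uR i v g) ∧ (∀ m, m < k + 1 ↔ 0 < uR i v g m) ∧
      ∑ m ∈ Finset.range (k + 1), uR i v g m + i = ∑ m ∈ Finset.range k, g m + v := by
  have e1 : Antitone (subR i g) := antitone_nat_of_succ_le fun m => by
    have h3 := h1 (Nat.le_succ m)
    have := ha m; have := ha (m + 1); 
    by_cases hm : m + 1 = i
    · subst hm; simp [subR]; omega
    · simp only [subR, Nat.succ_eq_add_one] at *; grind
  have e2 : ∀ m, m < k ↔ 0 < subR i g m := fun m => by
    have := h2 m; have := ha m
    simp only [subR]; grind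
  obtain ⟨a, b, c⟩ := ins_props (v := v) (i := i) e1 e2 hi hv
    (fun m hm => by have := ha m hm; simp [subR, hm]; omega) (by simp [subR, hb])
  refine ⟨a, b, ?_⟩
  rw [uR, c]
  have := sum_add (subR i g) i k hi
  rw [addR_subR i g (fun m hm => by have := ha m hm; omega)] at this
  omega

def DD (j n k : ℕ) := {x ∈ SS n k | j < x.1 ∧ x.2 (x.1 - 1 - j) < x.1}
def EE (j n k : ℕ) := {x ∈ SS n k | x.1 < k ∧ x.1 + j ≤ x.2 x.1}
def FF (j n k : ℕ) := {x ∈ SS n k | ∃ i < k, x.2 i = i + j}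

theorem exists_first (_g : ℕ → ℕ) (P : ℕ → Prop) (h : ∃ m, P m) : ∃ i, P i ∧ ∀ m < i, ¬ P m := by
  classical
  exact ⟨Nat.find h, Nat.find_spec h, fun _ hm => Nat.find_min h hm⟩

theorem EE_DD (j n k : ℕ) (hk : 0 < k + j) : (EE j n (k + 1)).ncard = (DD j n k).ncard := by
  apply ncard_rel _ _ (fun x y => y.1 = x.2 x.1 + 1 ∧ y.2 = hR x.1 x.2)
  · rintro ⟨w, f⟩ ⟨h, hw, hf⟩
    dsimp only at hw hf
    obtain ⟨a, b, c⟩ := SS_h h (show w ≤ k by omega)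
    refine ⟨(f w + 1, hR w f), ⟨⟨a, b, ?_⟩, ?_, ?_⟩, rfl, rfl⟩
    · dsimp only; omega
    · dsimp only; omega
    · dsimp only
      rw [hR_ge _ (by omega)]
      have := h.1 (show w ≤ f w + 1 - 1 - j + 1 by omega)
      dsimp only at this; omega
  · rintro ⟨w, g⟩ ⟨⟨h1, h2, h3⟩, h4, h5⟩
    dsimp only at h1 h2 h3 h4 h5
    obtain ⟨i, hi, hi'⟩ := exists_first g (fun m => g m < w) ⟨_, h5⟩
    have hik : i ≤ k := by
      by_contra hc
      have := hi' k (by omega)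
      have := h2 k
      omega
    have hiw : i ≤ w - 1 - j := by
      by_contra hc
      exact hi' (w-1-j) (by omega) h5
    have hw : 0 < w - 1 := by
      by_contra hc
      have e1 : w = 1 := by omega
      have e2 : j = 0 := by omega
      have := h2 0
      subst e1 e2
      simp at h5
      omega
    obtain ⟨a, b, c⟩ := u_props (v := w - 1) h1 h2 hik hw
      (fun m hm => by have := hi' m hm; omega) (by omega)
    refine ⟨(i, uR i (w-1) g), ⟨⟨a, b, ?_⟩, ?_, ?_⟩, ?_, ?_⟩
    · dsimp only; omega
    · dsimp only; omega
    · dsimp only; rw [uR_at]; omega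
    · dsimp only; rw [uR_at]; omega
    · dsimp only; rw [hu]; intro m hm; have := hi' m hm; omega
  · rintro x - ⟨a, b⟩ - ⟨c, d⟩ - ⟨h1, h2⟩ ⟨h3, h4⟩
    dsimp only at *
    rw [h1, h2, h3, h4]
  · rintro ⟨w, f⟩ ⟨h, -⟩ ⟨w', f'⟩ ⟨h', -⟩ ⟨v, g⟩ - ⟨h1, h2⟩ ⟨h3, h4⟩
    dsimp only at *
    have key : ∀ {w f}, Antitone f → v = f w + 1 → g = hR w f → (∀ m < w, v ≤ g m) ∧ g w < v := by
      intro w f hf e1 e2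
      subst e1 e2
      refine ⟨fun m hm => ?_, ?_⟩
      · rw [hR_lt _ hm]; have := hf hm.le; omega
      · rw [hR_ge _ le_rfl]; have := hf (Nat.le_succ w); simp at this; omega
    obtain ⟨a, b⟩ := key h.1 h1 h2
    obtain ⟨c, d⟩ := key h'.1 h3 h4
    have : w = w' := by
      rcases lt_trichotomy w w' with h | h | h
      · have := c _ h; omega
      · exact h
      · have := a _ h; omega
    subst this
    have : f = f' := by
      rw [← uh w f, ← uh w f', ← h2, ← h4]; congr 1; omega
    rw [this]

theorem FF_rec (j n k : ℕ) (hk : 0 < k + j) :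
    (FF j (n + j + 1) (k + 1)).ncard = (SS n k \ FF (j + 1) n k).ncard := by
  apply ncard_rel _ _ (fun x y => y.1 = x.1 ∧ ∃ i ≤ k, x.2 i = i + j ∧ y.2 = hR i x.2)
  · rintro ⟨w, f⟩ ⟨h, i, hi, hf⟩
    dsimp only at hi hf
    obtain ⟨a, b, c⟩ := SS_h h (show i ≤ k by omega)
    refine ⟨(w, hR i f), ⟨⟨a, b, ?_⟩, ?_⟩, rfl, i, by omega, hf, rfl⟩
    · dsimp only; omega
    · rintro ⟨-, m, hm, hm'⟩
      dsimp only at hm'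
      have h1 := h.1
      dsimp only at h1
      by_cases hmi : m < i
      · rw [hR_lt _ hmi] at hm'
        have := h1 hmi.le; omega
      · rw [hR_ge _ (by omega)] at hm'
        have := h1 (show i ≤ m + 1 by omega); omega
  · rintro ⟨w, g⟩ ⟨⟨h1, h2, h3⟩, h4⟩
    have h4' : ∀ i < k, g i ≠ i + (j + 1) := by
      intro i hi he
      exact h4 ⟨⟨h1, h2, h3⟩, i, hi, he⟩
    dsimp only at h1 h2 h3
    have hgk : g k < k + j + 1 := by have := h2 k; omega
    obtain ⟨i, hi, hi'⟩ := exists_first g (fun m => g m < m + j + 1) ⟨k, hgk⟩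
    have hik : i ≤ k := by
      by_contra hc
      exact hi' k (by omega) hgk
    have hp : 0 < i + j := by
      by_contra hc
      have e1 : i = 0 := by omega
      have e2 : j = 0 := by omega
      have := h2 0
      subst e1 e2
      simp at hi
      omega
    have hup : ∀ m < i, i + j + 1 ≤ g m := by
      intro m hm
      have e := hi' (i - 1) (by omega)
      have e' := h4' (i - 1) (by omega)
      have := h1 (show m ≤ i - 1 by omega)
      omega
    obtain ⟨a, b, c⟩ := u_props (v := i + j) h1 h2 hik hp hup (by omega)
    refine ⟨(w, uR i (i + j) g), ⟨⟨a, b, ?_⟩, i, by omega, ?_⟩, rfl, i, hik, ?_, ?_⟩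
    · dsimp only; omega
    · exact uR_at _ _ _
    · exact uR_at _ _ _
    · dsimp only; rw [hu]; intro m hm; have := hup m hm; omega
  · rintro ⟨w, f⟩ ⟨h, -⟩ ⟨a, b⟩ - ⟨c, d⟩ - ⟨h1, i, -, h2, h2'⟩ ⟨h3, i', -, h4, h4'⟩
    have hf := h.1
    dsimp only at *
    have : i = i' := by
      rcases le_total i i' with h | h
      · have := hf h; omega
      · have := hf h; omega
    rw [h1, h2', h3, h4', this]
  · rintro ⟨w, f⟩ ⟨h, -⟩ ⟨w', f'⟩ ⟨h', -⟩ ⟨v, g⟩ - ⟨h1, i, -, h2, h2'⟩ ⟨h3, i', -, h4, h4'⟩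
    dsimp only at *
    have key : ∀ {i f}, Antitone f → f i = i + j → g = hR i f →
        (∀ m < i, m + j + 2 ≤ g m) ∧ g i ≤ i + j := by
      intro i f hf e1 e2
      subst e2
      refine ⟨fun m hm => ?_, ?_⟩
      · rw [hR_lt _ hm]; have := hf hm.le; omega
      · rw [hR_ge _ le_rfl]; have := hf (Nat.le_succ i); simp at this; omega
    obtain ⟨a, b⟩ := key h.1 h2 h2'
    obtain ⟨c, d⟩ := key h'.1 h4 h4'
    have : i = i' := by
      rcases lt_trichotomy i i' with h | h | h
      · have := c _ h; omega
      · exact h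
      · have := a _ h; omega
    subst this
    have : f = f' := by
      rw [← uh i f, ← uh i f', ← h2', ← h4', h2, h4]
    rw [this, ← h1, ← h3]

theorem DD_rec (j n k : ℕ) : (DD j (n + j + 1) k).ncard = (SS n k \ EE (j + 1) n k).ncard := by
  apply ncard_rel _ _ (fun x y => x.1 = y.1 + j + 1 ∧ x.2 = y.2)
  · rintro ⟨w, f⟩ ⟨⟨h1, h2, h3⟩, h4, h5⟩
    dsimp only at *
    refine ⟨(w - 1 - j, f), ⟨⟨h1, h2, ?_⟩, ?_⟩, ?_, rfl⟩
    · dsimp only; omega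
    · rintro ⟨-, -, h⟩; dsimp only at h; omega
    · dsimp only; omega
  · rintro ⟨w, f⟩ ⟨⟨h1, h2, h3⟩, h4⟩
    have h4' : ¬ (w < k ∧ w + (j + 1) ≤ f w) := fun h => h4 ⟨⟨h1, h2, h3⟩, h⟩
    dsimp only at *
    refine ⟨(w + j + 1, f), ⟨⟨h1, h2, ?_⟩, ?_, ?_⟩, rfl, rfl⟩
    · dsimp only; omega
    · dsimp only; omega
    · dsimp only; rw [show w + j + 1 - 1 - j = w by omega]
      have := h2 w
      by_contra hc
      exact h4' ⟨by omega, by omega⟩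
  · rintro ⟨w, f⟩ - ⟨a, b⟩ - ⟨c, d⟩ - ⟨h1, h2⟩ ⟨h3, h4⟩
    dsimp only at *
    rw [← h2, ← h4, show a = c by omega]
  · rintro ⟨w, f⟩ - ⟨a, b⟩ - ⟨c, d⟩ - ⟨h1, h2⟩ ⟨h3, h4⟩
    dsimp only at *
    rw [h2, h4, show a = w by omega]

theorem DD_small (j n k : ℕ) (h : n ≤ j) : DD j n k = ∅ := by
  ext ⟨w, f⟩
  simp only [Set.mem_empty_iff_false, iff_false]
  rintro ⟨⟨h1, h2, h3⟩, h4, h5⟩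
  dsimp only at *
  omega
theorem EE_zero (j n : ℕ) : EE j n 0 = ∅ := by
  ext ⟨w, f⟩
  simp only [Set.mem_empty_iff_false, iff_false]
  rintro ⟨-, h4, h5⟩
  simp at h4
theorem FF_zero (j n : ℕ) : FF j n 0 = ∅ := by
  ext ⟨w, f⟩
  simp only [Set.mem_empty_iff_false, iff_false]
  rintro ⟨-, i, h5, -⟩
  simp at h5
theorem FF_small (j n k : ℕ) (h : n ≤ j) : FF j n (k + 1) = ∅ := by
  ext ⟨w, f⟩
  simp only [Set.mem_empty_iff_false, iff_false]
  rintro ⟨⟨h1, h2, h3⟩, i, h4, h5⟩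
  dsimp only at *
  have := Finset.single_le_sum (f := f) (s := Finset.range (k+1)) (fun _ _ => Nat.zero_le _) (Finset.mem_range.2 h4)
  omega

def memF (v : ℕ) (f : ℕ → ℕ) : Prop := ∃ m, f m = v

/-- the least `m > j` which is not a value is `j + 1 + 2 t` -/
def QQ (j : ℕ) (f : ℕ → ℕ) : Prop :=
  ∃ t, (∀ s, j < s → s ≤ j + 2 * t → memF s f) ∧ ¬ memF (j + 1 + 2 * t) f

theorem QQ_rec (j : ℕ) (f : ℕ → ℕ) (hf : Antitone f) :
    QQ j f ↔ ¬ (memF (j + 1) f ∧ QQ (j + 1) f) := by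
  constructor
  · rintro ⟨t, h1, h2⟩ ⟨h3, s, h4, h5⟩
    rcases le_or_gt t s with h | h
    · rcases Nat.eq_zero_or_pos t with h0 | h0
      · subst h0; exact h2 h3
      · exact h2 (h4 _ (by omega) (by omega))
    · exact h5 (h1 _ (by omega) (by omega))
  · intro h
    have hex : ∃ t, ¬ memF (j + 1 + t) f := by
      refine ⟨f 0, ?_⟩
      rintro ⟨m, hm⟩
      have := hf (Nat.zero_le m); omega
    obtain ⟨t, ht, ht'⟩ := exists_first f _ hex
    have ht2 : ∀ s, j < s → s < j + 1 + t → memF s f := by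
      intro s h1 h2
      have := ht' (s - j - 1) (by omega)
      rw [show j + 1 + (s - j - 1) = s by omega] at this
      exact not_not.1 this
    rcases Nat.even_or_odd' t with ⟨c, hc | hc⟩
    · exact ⟨c, fun s h1 h2 => ht2 s h1 (by omega), hc ▸ ht⟩
    · exfalso
      refine h ⟨ht2 _ (by omega) (by omega), c, fun s h1 h2 => ht2 s (by omega) (by omega), ?_⟩
      rw [show j + 1 + 1 + 2 * c = j + 1 + t by omega]; exact ht

def MM (j n k : ℕ) := {x ∈ SS n k | j < x.1 ∧ QQ j x.2}
def NN (j n k : ℕ) := {x ∈ SS n k | memF (j + 1) x.2 ∧ QQ (j + 1) x.2}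

theorem MM_rec (j n k : ℕ) : (MM j (n + j + 1) k).ncard = (SS n k \ NN j n k).ncard := by
  apply ncard_rel _ _ (fun x y => x.1 = y.1 + j + 1 ∧ x.2 = y.2)
  · rintro ⟨w, f⟩ ⟨⟨h1, h2, h3⟩, h4, h5⟩
    dsimp only at *
    refine ⟨(w - 1 - j, f), ⟨⟨h1, h2, ?_⟩, ?_⟩, ?_, rfl⟩
    · dsimp only; omega
    · rintro ⟨-, h⟩; exact (QQ_rec j f h1).1 h5 h
    · dsimp only; omega
  · rintro ⟨w, f⟩ ⟨⟨h1, h2, h3⟩, h4⟩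
    have h4' : ¬ (memF (j + 1) f ∧ QQ (j + 1) f) := fun h => h4 ⟨⟨h1, h2, h3⟩, h⟩
    dsimp only at *
    refine ⟨(w + j + 1, f), ⟨⟨h1, h2, ?_⟩, ?_, ?_⟩, rfl, rfl⟩
    · dsimp only; omega
    · dsimp only; omega
    · exact (QQ_rec j f h1).2 h4'
  · rintro ⟨w, f⟩ - ⟨a, b⟩ - ⟨c, d⟩ - ⟨h1, h2⟩ ⟨h3, h4⟩
    dsimp only at *
    rw [← h2, ← h4, show a = c by omega]
  · rintro ⟨w, f⟩ - ⟨a, b⟩ - ⟨c, d⟩ - ⟨h1, h2⟩ ⟨h3, h4⟩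
    dsimp only at *
    rw [h2, h4, show a = w by omega]

theorem MM_small (j n k : ℕ) (h : n ≤ j) : MM j n k = ∅ := by
  ext ⟨w, f⟩
  simp only [Set.mem_empty_iff_false, iff_false]
  rintro ⟨⟨h1, h2, h3⟩, h4, h5⟩
  dsimp only at *
  omega
theorem NN_zero (j n : ℕ) : NN j n 0 = ∅ := by
  ext ⟨w, f⟩
  simp only [Set.mem_empty_iff_false, iff_false]
  rintro ⟨⟨h1, h2, h3⟩, ⟨m, hm⟩, h5⟩
  have := h2 m
  dsimp only at *
  omega

theorem memF_del {i s : ℕ} {f : ℕ → ℕ} (h : s ≠ f i) : memF s (delR i f) ↔ memF s f := by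
  constructor
  · rintro ⟨m, hm⟩
    by_cases h' : m < i
    · exact ⟨m, by simpa [delR, h'] using hm⟩
    · exact ⟨m + 1, by simpa [delR, h'] using hm⟩
  · rintro ⟨m, rfl⟩
    rcases lt_trichotomy m i with h' | h' | h'
    · exact ⟨m, by simp [delR, h']⟩
    · subst h'; simp at h
    · refine ⟨m - 1, ?_⟩
      simp only [delR]
      rw [if_neg (by omega), Nat.sub_add_cancel (by omega)]

theorem QQ_congr {j : ℕ} {f g : ℕ → ℕ} (h : ∀ s, j < s → (memF s f ↔ memF s g)) :
    QQ j f ↔ QQ j g := by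
  unfold QQ
  refine exists_congr fun t => and_congr ?_ ?_
  · exact forall_congr' fun s => forall_congr' fun hs => by rw [h s hs]
  · rw [h _ (by omega)]

theorem NN_MM (j n k : ℕ) : (NN j n (k + 1)).ncard = (MM (j + 1) n k).ncard := by
  apply ncard_rel _ _ (fun x y => y.1 = x.1 + j + 2 ∧
    ∃ i ≤ k, x.2 i = j + 1 ∧ (∀ m < i, j + 1 < x.2 m) ∧ y.2 = delR i x.2)
  · rintro ⟨w, f⟩ ⟨h, h4, h5⟩
    obtain ⟨i, hi, hi'⟩ := exists_first f _ h4
    have h1 := h.1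
    have h2 := h.2.1
    dsimp only at *
    have hik : i ≤ k := by have := h2 i; omega
    obtain ⟨a, b, c⟩ := SS_del h hik
    refine ⟨(w + j + 2, delR i f), ⟨⟨a, b, ?_⟩, ?_, ?_⟩, rfl, i, hik, hi, ?_, rfl⟩
    · dsimp only; omega
    · dsimp only; omega
    · refine (QQ_congr fun s hs => memF_del ?_).2 h5
      omega
    · intro m hm
      have := hi' m hm
      have := h1 hm.le
      show j + 1 < f m
      omega
  · rintro ⟨w, g⟩ ⟨⟨h1, h2, h3⟩, h4, h5⟩
    dsimp only at *
    have hgk : g k ≤ j + 1 := by have := h2 k; omega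
    obtain ⟨i, hi, hi'⟩ := exists_first g (fun m => g m ≤ j + 1) ⟨k, hgk⟩
    have hik : i ≤ k := by
      by_contra hc
      exact hi' k (by omega) hgk
    obtain ⟨a, b, c⟩ := ins_props (v := j + 1) h1 h2 hik (by omega)
      (fun m hm => by have := hi' m hm; omega) hi
    refine ⟨(w - j - 2, insR i (j + 1) g), ⟨⟨a, b, ?_⟩, ⟨i, ins_at _ _ _⟩, ?_⟩, ?_, i, hik,
      ins_at _ _ _, ?_, ?_⟩
    · dsimp only; omega
    · dsimp only
      refine (QQ_congr fun s hs => ?_).1 h5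
      have := memF_del (i := i) (s := s) (f := insR i (j + 1) g) (by rw [ins_at]; omega)
      rw [del_ins] at this
      exact this
    · dsimp only; omega
    · intro m hm
      have := hi' m hm
      simp [insR, hm]; omega
    · exact (del_ins _ _ _).symm
  · rintro ⟨w, f⟩ - ⟨a, b⟩ - ⟨c, d⟩ - ⟨h1, i, -, h2, h2', e⟩ ⟨h3, i', -, h4, h4', e'⟩
    dsimp only at *
    have : i = i' := by
      rcases lt_trichotomy i i' with h | h | h
      · have := h4' _ h; omega
      · exact h
      · have := h2' _ h; omega
    rw [h1, h3, e, e', this]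
  · rintro ⟨w, f⟩ ⟨h, -⟩ ⟨w', f'⟩ ⟨h', -⟩ ⟨v, g⟩ - ⟨h1, i, -, h2, h2', e⟩ ⟨h3, i', -, h4, h4', e'⟩
    dsimp only at *
    have key : ∀ {i f}, Antitone f → f i = j + 1 → (∀ m < i, j + 1 < f m) → g = delR i f →
        (∀ m < i, j + 1 < g m) ∧ g i ≤ j + 1 := by
      intro i f hf e1 e2 e3
      subst e3
      refine ⟨fun m hm => ?_, ?_⟩
      · simp [delR, hm, e2 m hm]
      · have := hf (Nat.le_succ i); simp at this; simp [delR]; omega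
    obtain ⟨a, b⟩ := key h.1 h2 h2' e
    obtain ⟨c, d⟩ := key h'.1 h4 h4' e'
    have : i = i' := by
      rcases lt_trichotomy i i' with h | h | h
      · have := c _ h; omega
      · exact h
      · have := a _ h; omega
    subst this
    have : f = f' := by
      rw [← ins_del i f, ← ins_del i f', ← e, ← e', h2, h4]
    rw [this, show w = w' by omega]

theorem main_rec (hfin : ∀ n k, (SS n k).Finite) (k : ℕ) : ∀ j n,
    (MM j n k).ncard = (DD j n k).ncard ∧
    (0 < k + j → (FF j n (k + 1)).ncard = (DD j n k).ncard) := by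
  have split : ∀ {n k} {A B : Set (ℕ × (ℕ → ℕ))}, A ⊆ SS n k → B ⊆ SS n k → A.ncard = B.ncard →
      (SS n k \ A).ncard = (SS n k \ B).ncard := by
    intro n k A B hA hB h
    rw [Set.ncard_sdiff hA ((hfin n k).subset hA), Set.ncard_sdiff hB ((hfin n k).subset hB), h]
  induction k with
  | zero =>
    intro j n
    rcases Nat.lt_or_ge j n with h | h
    · obtain ⟨n, rfl⟩ : ∃ m, n = m + j + 1 := ⟨n - j - 1, by omega⟩
      rw [MM_rec, DD_rec, EE_zero, NN_zero]
      refine ⟨rfl, fun h => ?_⟩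
      rw [FF_rec _ _ _ h, FF_zero]
    · rw [MM_small _ _ _ h, DD_small _ _ _ h]
      exact ⟨rfl, fun _ => by rw [FF_small _ _ _ h]⟩
  | succ k ih =>
    intro j n
    rcases Nat.lt_or_ge j n with h | h
    · obtain ⟨n, rfl⟩ : ∃ m, n = m + j + 1 := ⟨n - j - 1, by omega⟩
      rw [MM_rec, DD_rec]
      refine ⟨?_, fun h => ?_⟩
      · apply split (A := NN j n (k + 1)) (B := EE (j + 1) n (k + 1)) (Set.sep_subset _ _)
          (Set.sep_subset _ _)
        rw [NN_MM, EE_DD _ _ _ (by omega), (ih _ _).1]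
      · rw [FF_rec _ _ _ h]
        apply split (A := FF (j + 1) n (k + 1)) (B := EE (j + 1) n (k + 1)) (Set.sep_subset _ _)
          (Set.sep_subset _ _)
        rw [EE_DD _ _ _ (by omega), (ih _ _).2 (by omega)]
    · rw [MM_small _ _ _ h, DD_small _ _ _ h]
      exact ⟨rfl, fun _ => by rw [FF_small _ _ _ h]⟩

def LL (k : ℕ) (x : ℕ × (ℕ → ℕ)) : List ℕ :=
  (List.range k).map (fun m => x.2 m + 1) ++ List.replicate x.1 1

theorem LL_sorted (k : ℕ) (x : ℕ × (ℕ → ℕ)) (h : Antitone x.2) : (LL k x).Pairwise (· ≥ ·) := by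
  rw [LL, List.pairwise_append]
  refine ⟨?_, ?_, ?_⟩
  · rw [List.pairwise_map]
    refine List.Pairwise.imp ?_ (List.pairwise_lt_range (n := k))
    intro a b hab
    have := h hab.le
    omega
  · rw [List.pairwise_replicate]; simp
  · intro a ha b hb
    rw [List.eq_of_mem_replicate hb]
    simp at ha
    omega

theorem sorted_of_coe {n : ℕ} (p : n.Partition) (l : List ℕ) (hl : l.Pairwise (· ≥ ·))
    (h : p.parts = ↑l) : sortedParts p = l := by
  apply List.Perm.eq_of_pairwise' (r := (· ≥ ·)) (Multiset.pairwise_sort _ _) hl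
  rw [← Multiset.coe_eq_coe, Multiset.sort_eq, h]

theorem coe_of_sorted {n : ℕ} {p : n.Partition} {l : List ℕ} (h : sortedParts p = l) :
    p.parts = ↑l := by
  rw [← h, sortedParts, Multiset.sort_eq]

theorem T4 {n : ℕ} (p q : n.Partition) (h : sortedParts p = sortedParts q) : p = q := by
  apply Nat.Partition.ext
  rw [coe_of_sorted h, ← coe_of_sorted rfl]

theorem LL_sum (k : ℕ) (x : ℕ × (ℕ → ℕ)) :
    (LL k x).sum = x.1 + ∑ m ∈ Finset.range k, x.2 m + k := by
  simp only [LL, List.sum_append, List.sum_replicate, smul_eq_mul, mul_one]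
  have : ((List.range k).map (fun m => x.2 m + 1)).sum = ∑ m ∈ Finset.range k, (x.2 m + 1) := by
    rfl
  rw [this, Finset.sum_add_distrib]
  simp
  omega

theorem T2 (n k : ℕ) (x : ℕ × (ℕ → ℕ)) (hx : x ∈ SS n k) :
    ∃ p : n.Partition, sortedParts p = LL k x := by
  refine ⟨⟨↑(LL k x), ?_, ?_⟩, sorted_of_coe _ _ (LL_sorted k x hx.1) rfl⟩
  · intro i hi
    simp [LL] at hi
    omega
  · rw [Multiset.sum_coe, LL_sum, hx.2.2]

theorem LL_getD (k : ℕ) (x : ℕ × (ℕ → ℕ)) (m : ℕ) (h : m < k) : (LL k x).getD m 0 = x.2 m + 1 := by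
  simp [LL, List.getD_eq_getElem?_getD, List.getElem?_append, h]

theorem LL_length (k : ℕ) (x : ℕ × (ℕ → ℕ)) : (LL k x).length = k + x.1 := by simp [LL]

theorem T3 (n k : ℕ) (x y : ℕ × (ℕ → ℕ)) (hx : x ∈ SS n k) (hy : y ∈ SS n k)
    (h : LL k x = LL k y) : x = y := by
  have h1 := LL_length k x
  have h2 := LL_length k y
  rw [h] at h1
  refine Prod.ext (by omega) (funext fun m => ?_)
  by_cases hm : m < k
  · have := LL_getD k x m hm
    rw [h, LL_getD k y m hm] at this
    omega
  · have := hx.2.1 m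
    have := hy.2.1 m
    omega

theorem fin_SS (n k : ℕ) : (SS n k).Finite := by
  choose f hf using T2 n k
  classical
  refine Set.Finite.of_injOn (t := (Set.univ : Set n.Partition))
    (f := fun x => if h : x ∈ SS n k then f x h else Nat.Partition.indiscrete n)
    (fun _ _ => Set.mem_univ _) ?_ Set.finite_univ
  intro x hx y hy h
  simp only [hx, hy, dif_pos] at h
  apply T3 n k x y hx hy
  rw [← hf x hx, ← hf y hy, h]

theorem filt (l : ℕ → ℕ) (hl : Antitone l) (k t i : ℕ) :
    i < ((List.range k).filter (fun m => t < l m)).length ↔ i < k ∧ t < l i := by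
  induction k with
  | zero => simp
  | succ k ih =>
    rw [List.range_succ, List.filter_append, List.length_append]
    have hle : ((List.range k).filter (fun m => t < l m)).length ≤ k := by
      simpa using List.length_filter_le (fun m => decide (t < l m)) (List.range k)
    by_cases h : t < l k
    · have hall : ((List.range k).filter (fun m => t < l m)).length = k := by
        rw [List.filter_eq_self.2]
        · simp
        · intro m hm
          simp at hm
          have := hl hm.le
          simp; omega
      rw [hall]
      simp [h]
      intro hi
      have := hl (show i ≤ k by omega)
      omega
    · simp only [h, decide_false, List.filter_cons, List.filter_nil]
      simp only [Bool.false_eq_true, if_false, List.length_nil, add_zero, ih]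
      constructor
      · rintro ⟨a, b⟩; exact ⟨by omega, b⟩
      · rintro ⟨a, b⟩
        refine ⟨?_, b⟩
        by_contra hc
        have : i = k := by omega
        subst this; exact h b

theorem om_LL {n k : ℕ} {p : n.Partition} {x : ℕ × (ℕ → ℕ)} (hx : x ∈ SS n k)
    (h : sortedParts p = LL k x) : omegaStat p = x.1 := by
  rw [omegaStat, coe_of_sorted h, Multiset.coe_count, LL, List.count_append, List.count_replicate]
  simp
  rw [List.count_eq_zero]
  simp
  intro m hm
  have := hx.2.1 m
  omega

theorem beta_LL {n k : ℕ} {p : n.Partition} {x : ℕ × (ℕ → ℕ)} (hx : x ∈ SS n k)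
    (h : sortedParts p = LL k x) : betaStat p = k := by
  rw [betaStat, coe_of_sorted h, Multiset.filter_coe, Multiset.coe_card, LL, List.filter_append,
    List.length_append, List.filter_eq_self.2, List.filter_eq_nil_iff.2]
  · simp
  · intro a ha; rw [List.eq_of_mem_replicate ha]; simp
  · intro a ha
    simp at ha
    obtain ⟨m, hm, rfl⟩ := ha
    have := hx.2.1 m
    simp; omega

/-- for positive omega -/
theorem mu_LL {n k : ℕ} {p : n.Partition} {x : ℕ × (ℕ → ℕ)} (hx : x ∈ SS n k)
    (h : sortedParts p = LL k x) (hw : 0 < x.1) (i : ℕ) :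
    i < muStat p ↔ i < k ∧ x.1 ≤ x.2 i := by
  rw [muStat, om_LL hx h, coe_of_sorted h, Multiset.filter_coe, Multiset.coe_card, LL,
    List.filter_append, List.length_append, List.filter_eq_nil_iff (l := List.replicate _ _) |>.2,
    List.filter_map, List.length_map]
  · have := filt (fun m => x.2 m + 1) (fun a b hab => by have := hx.1 hab; simpa using this) k x.1 i
    simp only [List.length_nil, add_zero]
    rw [Nat.lt_succ_iff] at this
    exact this
  · intro a ha; rw [List.eq_of_mem_replicate ha]; simp; omega

theorem T1 (n k : ℕ) (p : n.Partition) (h : betaStat p = k) :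
    ∃ x ∈ SS n k, sortedParts p = LL k x := by
  set A := (p.parts.filter (fun x => 1 < x)).sort (· ≥ ·) with hA
  have hlen : A.length = k := by rw [hA, Multiset.length_sort]; exact h
  have hgt : ∀ a ∈ A, 1 < a := by
    intro a ha
    rw [hA, Multiset.mem_sort] at ha
    exact (Multiset.mem_filter.1 ha).2
  have hs : A.Pairwise (· ≥ ·) := Multiset.pairwise_sort _ _
  have hpos : ∀ m, m < k ↔ 0 < A.getD m 0 - 1 := by
    intro m
    constructor
    · intro hm
      rw [List.getD_eq_getElem _ _ (by omega)]
      have := hgt A[m] (List.getElem_mem _)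
      omega
    · intro hm
      by_contra hc
      rw [List.getD_eq_default _ _ (by omega)] at hm
      simp at hm
  have hmap : (List.range k).map (fun m => A.getD m 0 - 1 + 1) = A := by
    apply List.ext_getElem
    · simp [hlen]
    · intro m h1 h2
      have := hgt A[m] (List.getElem_mem _)
      simp [h2]
      omega
  have hanti : Antitone (fun m => A.getD m 0 - 1) := by
    intro a b hab
    rcases hab.eq_or_lt with rfl | hab
    · rfl
    by_cases hb : b < A.length
    · have := List.pairwise_iff_getElem.1 hs a b (by omega) hb hab
      simp only [List.getD_eq_getElem _ _ hb, List.getD_eq_getElem _ _ (hab.trans hb)]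
      omega
    · simp only [List.getD_eq_default _ _ (not_lt.1 hb)]
      omega
  have hparts : p.parts = ↑(LL k (omegaStat p, fun m => A.getD m 0 - 1)) := by
    rw [LL]
    simp only
    rw [hmap, ← Multiset.coe_add, hA, Multiset.sort_eq, omegaStat, Multiset.coe_replicate,
      ← Multiset.filter_eq']
    conv_lhs => rw [← Multiset.filter_add_not (fun x => 1 < x) p.parts]
    congr 1
    apply Multiset.filter_congr
    intro a ha
    have := p.parts_pos ha
    omega
  refine ⟨(omegaStat p, fun m => A.getD m 0 - 1), ⟨hanti, hpos, ?_⟩, ?_⟩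
  · rw [← LL_sum, ← Multiset.sum_coe, ← hparts, p.parts_sum]
  · exact sorted_of_coe _ _ (LL_sorted _ _ hanti) hparts

theorem transfer (n k : ℕ) (C : n.Partition → Prop) (C' : ℕ × (ℕ → ℕ) → Prop)
    (h : ∀ p x, x ∈ SS n k → sortedParts p = LL k x → (C p ↔ C' x)) :
    {p : n.Partition | C p ∧ betaStat p = k}.ncard = {x ∈ SS n k | C' x}.ncard := by
  apply ncard_rel _ _ (fun p x => sortedParts p = LL k x)
  · rintro p ⟨h1, h2⟩
    obtain ⟨x, hx, hp⟩ := T1 n k p h2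
    exact ⟨x, ⟨hx, (h p x hx hp).1 h1⟩, hp⟩
  · rintro x ⟨h1, h2⟩
    obtain ⟨p, hp⟩ := T2 n k x h1
    exact ⟨p, ⟨(h p x h1 hp).2 h2, beta_LL h1 hp⟩, hp⟩
  · rintro p - x ⟨hx, -⟩ y ⟨hy, -⟩ h1 h2
    exact T3 n k x y hx hy (h1.symm.trans h2)
  · rintro p - q - x - h1 h2
    exact T4 p q (h1.trans h2.symm)

theorem tr_neg (n k : ℕ) :
    {p : n.Partition | crank p < 0 ∧ betaStat p = k}.ncard = (DD 0 n k).ncard := by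
  apply transfer
  intro p x hx hp
  have ho := om_LL hx hp
  rw [crank, ho]
  by_cases hw : x.1 = 0
  · rw [if_pos hw]; simp [hw]
  · rw [if_neg hw]
    have := mu_LL hx hp (by omega) (x.1 - 1)
    have h2 := hx.2.1 (x.1 - 1)
    rw [Nat.sub_zero]
    constructor
    · intro h; refine ⟨by omega, ?_⟩
      by_contra hc
      have := this.2 ⟨by omega, by omega⟩
      omega
    · rintro ⟨h3, h4⟩
      by_contra hc
      have := this.1 (by omega)
      omega

theorem tr_pos (n k : ℕ) :
    {p : n.Partition | 0 < crank p ∧ betaStat p = k + 1}.ncard = (EE 0 n (k + 1)).ncard := by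
  apply transfer
  intro p x hx hp
  have ho := om_LL hx hp
  rw [crank, ho]
  by_cases hw : x.1 = 0
  · rw [if_pos hw]; simp only [hw]
    simp
    have hm : x.2 0 + 1 ∈ p.parts := by
      rw [coe_of_sorted hp, Multiset.mem_coe, LL]
      simp
      exact Or.inl ⟨0, by omega, rfl⟩
    have := Multiset.le_sup hm
    omega
  · rw [if_neg hw]
    have := mu_LL hx hp (by omega) x.1
    constructor
    · intro h
      exact this.1 (by omega)
    · intro h
      have := this.2 h
      omega

theorem tr_fix (n k : ℕ) :
    {p : n.Partition | hasFixedPoint p ∧ betaStat p = k + 1}.ncard = (FF 0 n (k + 1)).ncard := by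
  apply transfer
  intro p x hx hp
  rw [hasFixedPoint, hp]
  constructor
  · rintro ⟨i, h1, h2, h3⟩
    by_cases hi : i - 1 < k + 1
    · rw [LL_getD _ _ _ hi] at h3
      exact ⟨i - 1, hi, by omega⟩
    · exfalso
      rw [LL_length] at h2
      rw [LL, List.getD_append_right _ _ _ _ (by simp; omega)] at h3
      rw [List.getD_replicate _ (by simp; omega)] at h3
      omega
  · rintro ⟨i, h1, h2⟩
    refine ⟨i + 1, by omega, by rw [LL_length]; omega, ?_⟩
    rw [Nat.add_sub_cancel, LL_getD _ _ _ h1]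
    omega

theorem mem_LL {n k : ℕ} {p : n.Partition} {x : ℕ × (ℕ → ℕ)} (hx : x ∈ SS n k)
    (h : sortedParts p = LL k x) (s : ℕ) (hs : 0 < s) : s + 1 ∈ p.parts ↔ memF s x.2 := by
  rw [coe_of_sorted h, Multiset.mem_coe, LL, List.mem_append, List.mem_map, List.mem_replicate, memF]
  constructor
  · rintro (⟨m, hm, h⟩ | h)
    · exact ⟨m, by omega⟩
    · omega
  · rintro ⟨m, rfl⟩
    exact Or.inl ⟨m, List.mem_range.2 ((hx.2.1 m).2 hs), rfl⟩

theorem tr_mex (n k : ℕ) :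
    {p : n.Partition | Even (mex p) ∧ betaStat p = k}.ncard = (MM 0 n k).ncard := by
  apply transfer
  intro p x hx hp
  have hone : 1 ∈ p.parts ↔ 0 < x.1 := by
    rw [← om_LL hx hp, omegaStat, Multiset.count_pos]
  have hne : {m : ℕ | 0 < m ∧ m ∉ p.parts}.Nonempty := by
    refine ⟨n + 1, by omega, fun hc => ?_⟩
    have := Nat.Partition.le_of_mem_parts hc
    omega
  have hmem := Nat.sInf_mem hne
  have hlow : ∀ s, 0 < s → s < mex p → s ∈ p.parts := by
    intro s h1 h2
    by_contra hc
    exact Nat.notMem_of_lt_sInf h2 ⟨h1, hc⟩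
  change 0 < mex p ∧ mex p ∉ p.parts at hmem
  obtain ⟨h1, h2⟩ := hmem
  constructor
  · rintro ⟨c, hc⟩
    refine ⟨hone.1 (hlow 1 (by omega) (by omega)), c - 1, ?_, ?_⟩
    · intro s hs hs'
      exact (mem_LL hx hp s hs).1 (hlow _ (by omega) (by omega))
    · rw [← mem_LL hx hp _ (by omega), show 0 + 1 + 2 * (c - 1) + 1 = mex p by omega]
      exact h2
  · rintro ⟨h3, t, h4, h5⟩
    rw [← mem_LL hx hp _ (by omega)] at h5
    have : mex p = 2 * t + 2 := by
      rcases lt_trichotomy (mex p) (2 * t + 2) with h | h | h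
      · exfalso
        apply h2
        by_cases h' : mex p = 1
        · rw [h']; exact hone.2 h3
        · have := (mem_LL hx hp (mex p - 1) (by omega)).2 (h4 _ (by omega) (by omega))
          rwa [Nat.sub_add_cancel h1] at this
      · exact h
      · exact absurd (hlow _ (by omega) (by omega)) h5
    rw [this]
    exact ⟨t + 1, by omega⟩

theorem even_mex_fixed_point_crank_refined (n k : ℕ) (hn : 0 < n) (hk : 0 < k) :
    {p : Nat.Partition n | Even (mex p) ∧ betaStat p = k}.ncard = {p : Nat.Partition n | hasFixedPoint p ∧ betaStat p = k + 1}.ncard ∧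
    {p : Nat.Partition n | Even (mex p) ∧ betaStat p = k}.ncard = {p : Nat.Partition n | crank p < 0 ∧ betaStat p = k}.ncard ∧
    {p : Nat.Partition n | Even (mex p) ∧ betaStat p = k}.ncard = {p : Nat.Partition n | 0 < crank p ∧ betaStat p = k + 1}.ncard := by
  obtain ⟨h1, h2⟩ := main_rec fin_SS k 0 n
  rw [tr_mex, tr_fix, tr_neg, tr_pos, h1, h2 (by omega), EE_DD 0 n k (by omega)]
  exact ⟨rfl, rfl, rfl⟩
end

section
/- For all positive integers n and k, the number of partitions of n with even mex and exactly k parts greater than 1 equals the number of partitions of n with a fixed point and exactly k+1 parts greater than 1. -/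
open scoped Classical

namespace EvenMex

/-- Number of elements greater than `j`. -/
noncomputable def gtc (s : Multiset ℕ) (j : ℕ) : ℕ := (s.filter (fun x => j < x)).card

/-- Fixed point predicate on multisets. -/
def Fix (s : Multiset ℕ) : Prop := ∃ j, gtc s (j+1) ≤ j ∧ j < gtc s j

noncomputable def mx (s : Multiset ℕ) : ℕ := sInf {m : ℕ | 0 < m ∧ m ∉ s}

def PS (n : ℕ) (Q : Multiset ℕ → Prop) : Set (Multiset ℕ) := {s | 0 ∉ s ∧ s.sum = n ∧ Q s}

noncomputable def N (n : ℕ) (Q : Multiset ℕ → Prop) : ℕ := (PS n Q).ncard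

lemma PS_image (n : ℕ) (Q : Multiset ℕ → Prop) :
    PS n Q = (fun p : n.Partition => p.parts) '' {p | Q p.parts} := by
  ext s
  constructor
  · rintro ⟨h0, hs, hq⟩
    exact ⟨⟨s, fun {i} hi => Nat.pos_of_ne_zero (fun h => h0 (h ▸ hi)), hs⟩, hq, rfl⟩
  · rintro ⟨p, hp, rfl⟩
    exact ⟨fun h => absurd (p.parts_pos h) (lt_irrefl 0), p.parts_sum, hp⟩

lemma PS_finite (n : ℕ) (Q : Multiset ℕ → Prop) : (PS n Q).Finite := by
  rw [PS_image]; exact (Set.toFinite _).image _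

lemma N_partition (n : ℕ) (Q : Multiset ℕ → Prop) :
    {p : n.Partition | Q p.parts}.ncard = N n Q := by
  rw [N, PS_image, Set.ncard_image_of_injective]
  intro p q h
  exact Nat.Partition.ext h

lemma N_congr {n : ℕ} {Q Q' : Multiset ℕ → Prop}
    (h : ∀ s, 0 ∉ s → s.sum = n → (Q s ↔ Q' s)) : N n Q = N n Q' := by
  unfold N
  congr 1
  ext s
  constructor
  · rintro ⟨a, b, c⟩; exact ⟨a, b, (h s a b).1 c⟩
  · rintro ⟨a, b, c⟩; exact ⟨a, b, (h s a b).2 c⟩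

lemma N_split (n : ℕ) (Q R : Multiset ℕ → Prop) :
    N n Q = N n (fun s => R s ∧ Q s) + N n (fun s => ¬ R s ∧ Q s) := by
  unfold N
  rw [← Set.ncard_union_eq _ (PS_finite _ _) (PS_finite _ _)]
  · congr 1
    ext s
    simp only [PS, Set.mem_union, Set.mem_ofPred_eq]
    tauto
  · rw [Set.disjoint_left]
    rintro s ⟨_, _, h, _⟩ ⟨_, _, h', _⟩
    exact h' h

lemma N_zero {n : ℕ} {Q : Multiset ℕ → Prop} (h : ∀ s, 0 ∉ s → s.sum = n → ¬ Q s) :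
    N n Q = 0 := by
  unfold N
  rw [Set.ncard_eq_zero (PS_finite _ _), Set.eq_empty_iff_forall_notMem]
  rintro s ⟨a, b, c⟩
  exact h s a b c

lemma N_cons (n : ℕ) (Q : Multiset ℕ → Prop) :
    N (n+1) (fun s => 1 ∈ s ∧ Q s) = N n (fun s => Q (1 ::ₘ s)) := by
  unfold N
  rw [← Set.ncard_image_of_injective (PS n _) (fun a b h => (Multiset.cons_inj_right 1).1 h : Function.Injective (fun s : Multiset ℕ => 1 ::ₘ s))]
  congr 1
  ext s
  constructor
  · rintro ⟨h0, hs, h1, hq⟩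
    obtain ⟨t, rfl⟩ := Multiset.exists_cons_of_mem h1
    refine ⟨t, ⟨fun h => h0 (Multiset.mem_cons_of_mem h), ?_, hq⟩, rfl⟩
    simp at hs; omega
  · rintro ⟨t, ⟨h0, hs, hq⟩, rfl⟩
    refine ⟨by simpa using h0, by simp [hs]; omega, by simp, hq⟩

lemma sum_map_succ (s : Multiset ℕ) : (s.map Nat.succ).sum = s.sum + s.card := by
  induction s using Multiset.induction with
  | empty => simp
  | cons a s ih => simp [ih]; omega

lemma N_succ (m k : ℕ) (Q : Multiset ℕ → Prop) :
    N (m+k) (fun s => 1 ∉ s ∧ s.card = k ∧ Q s)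
      = N m (fun s => s.card = k ∧ Q (s.map Nat.succ)) := by
  unfold N
  rw [← Set.ncard_image_of_injective (PS m _) (Multiset.map_injective Nat.succ_injective)]
  congr 1
  ext s
  constructor
  · rintro ⟨h0, hs, h1, hc, hq⟩
    have key : (s.map Nat.pred).map Nat.succ = s := by
      rw [Multiset.map_map]
      conv_rhs => rw [← Multiset.map_id s]
      apply Multiset.map_congr rfl
      intro x hx
      have : x ≠ 0 := fun h => h0 (h ▸ hx)
      simp; omega
    refine ⟨s.map Nat.pred, ⟨?_, ?_, by simpa using hc, by rw [key]; exact hq⟩, key⟩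
    · intro h
      obtain ⟨x, hx, hx'⟩ := Multiset.mem_map.1 h
      have : x ≠ 0 := fun h => h0 (h ▸ hx)
      have : x ≠ 1 := fun h => h1 (h ▸ hx)
      simp at hx'; omega
    · have := sum_map_succ (s.map Nat.pred)
      rw [key] at this
      simp only [Multiset.card_map] at this
      omega
  · rintro ⟨t, ⟨h0, hs, hc, hq⟩, rfl⟩
    refine ⟨by simp, by rw [sum_map_succ]; omega, by simpa using h0, by simpa using hc, hq⟩

/-! gtc lemmas -/

lemma gtc_zero (j : ℕ) : gtc 0 j = 0 := by simp [gtc]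

lemma gtc_cons (a : ℕ) (s : Multiset ℕ) (j : ℕ) :
    gtc (a ::ₘ s) j = gtc s j + if j < a then 1 else 0 := by
  unfold gtc
  split_ifs with h
  · rw [Multiset.filter_cons_of_pos _ h]; simp
  · rw [Multiset.filter_cons_of_neg _ h]; simp

lemma gtc_add (s t : Multiset ℕ) (j : ℕ) : gtc (s + t) j = gtc s j + gtc t j := by
  simp [gtc]

lemma gtc_anti (s : Multiset ℕ) {i j : ℕ} (h : i ≤ j) : gtc s j ≤ gtc s i := by
  induction s using Multiset.induction with
  | empty => simp [gtc]
  | cons a s ih => rw [gtc_cons, gtc_cons]; split_ifs <;> omega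

lemma gtc_le_card (s : Multiset ℕ) (j : ℕ) : gtc s j ≤ s.card :=
  Multiset.card_le_card (Multiset.filter_le _ _)

lemma gtc_eq_card {s : Multiset ℕ} {j : ℕ} (h : ∀ x ∈ s, j < x) : gtc s j = s.card := by
  unfold gtc; rw [Multiset.filter_eq_self.2 h]

lemma gtc_eq_zero {s : Multiset ℕ} {j : ℕ} (h : ∀ x ∈ s, x ≤ j) : gtc s j = 0 := by
  unfold gtc
  rw [Multiset.filter_eq_nil.2]
  · simp
  · intro x hx; have := h x hx; omega

lemma gtc_zero_of (s : Multiset ℕ) (h : 0 ∉ s) : gtc s 0 = s.card :=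
  gtc_eq_card (fun x hx => Nat.pos_of_ne_zero (fun h' => h (h' ▸ hx)))

lemma gtc_one_of (s : Multiset ℕ) (h : 0 ∉ s) (h1 : 1 ∉ s) : gtc s 1 = s.card :=
  gtc_eq_card (fun x hx => by
    have : x ≠ 0 := fun h' => h (h' ▸ hx)
    have : x ≠ 1 := fun h' => h1 (h' ▸ hx)
    omega)

lemma not_fix_iff (s : Multiset ℕ) : ¬ Fix s ↔ ∃ j, gtc s j = j := by
  constructor
  · intro h
    have hex : ∃ j, gtc s j ≤ j := ⟨s.card, gtc_le_card _ _⟩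
    refine ⟨Nat.find hex, ?_⟩
    have h1 := Nat.find_spec hex
    by_contra hne
    apply h
    obtain ⟨i, hi⟩ : ∃ i, Nat.find hex = i + 1 := ⟨Nat.find hex - 1, by omega⟩
    have h2 := Nat.find_min hex (m := i) (by omega)
    rw [hi] at h1 hne
    exact ⟨i, by omega, by omega⟩
  · rintro ⟨j, hj⟩ ⟨i, h1, h2⟩
    rcases le_or_gt j i with h | h
    · have := gtc_anti s h; omega
    · have := gtc_anti s (show i + 1 ≤ j from h); omega

lemma fix_cons_one (t : Multiset ℕ) (h0 : 0 ∉ t) (ht : 0 < t.card) :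
    Fix (1 ::ₘ t) ↔ Fix t := by
  unfold Fix
  simp only [gtc_cons]
  apply exists_congr
  intro j
  have := gtc_zero_of t h0
  rcases j with _ | j
  · simp; omega
  · simp

/-! mex -/

lemma mx_spec (s : Multiset ℕ) : 0 < mx s ∧ mx s ∉ s := by
  have : {m : ℕ | 0 < m ∧ m ∉ s}.Nonempty := by
    refine ⟨s.sum + 1, by omega, fun h => ?_⟩
    have := Multiset.le_sum_of_mem h
    omega
  exact Nat.sInf_mem this

lemma mx_min (s : Multiset ℕ) {i : ℕ} (hi : 0 < i) (h : i < mx s) : i ∈ s := by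
  by_contra hh
  exact Nat.notMem_of_lt_sInf h ⟨hi, hh⟩

lemma mx_eq {s : Multiset ℕ} {m : ℕ} (h0 : 0 < m) (h1 : m ∉ s)
    (h2 : ∀ i, 0 < i → i < m → i ∈ s) : mx s = m := by
  apply le_antisymm
  · exact Nat.sInf_le ⟨h0, h1⟩
  · by_contra h
    exact (mx_spec s).2 (h2 _ (mx_spec s).1 (by omega))

lemma mx_cons_of_mem {s : Multiset ℕ} (h : 1 ∈ s) : mx (1 ::ₘ s) = mx s := by
  unfold mx
  congr 1
  ext m
  simp only [Set.mem_ofPred_eq, Multiset.mem_cons]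
  constructor
  · tauto
  · rintro ⟨a, b⟩
    refine ⟨a, ?_⟩
    rintro (rfl | h')
    · exact b h
    · exact b h'

lemma mx_shift (s : Multiset ℕ) : mx (1 ::ₘ s.map Nat.succ) = mx s + 1 := by
  have h := mx_spec s
  apply mx_eq (by omega)
  · simp; exact ⟨by omega, h.2⟩
  · intro i hi hi'
    rcases i with _ | i
    · omega
    · rcases Nat.eq_zero_or_pos i with rfl | hp
      · simp
      · have := mx_min s hp (by omega)
        simp [this]

lemma even_mx_mem {s : Multiset ℕ} (h : Even (mx s)) : 1 ∈ s := by
  apply mx_min s one_pos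
  have := (mx_spec s).1
  rcases h with ⟨r, hr⟩
  omega

/-! counting functions -/

noncomputable def A (n k : ℕ) := N n (fun s => s.card = k ∧ Even (mx s))
noncomputable def B (n k : ℕ) := N n (fun s => s.card = k ∧ Fix s)
noncomputable def M (n k : ℕ) := N n (fun s => gtc s 1 = k ∧ Even (mx s))
noncomputable def F (n k : ℕ) := N n (fun s => gtc s 1 = k ∧ Fix s)
noncomputable def E (n k : ℕ) := N n (fun s => 1 ∉ s ∧ s.card = k ∧ Even (mx (1 ::ₘ s)))
noncomputable def D (n k : ℕ) := N n (fun s => 1 ∉ s ∧ s.card = k ∧ Fix s)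
noncomputable def NA (n k : ℕ) := N n (fun s => s.card = k ∧ ¬ Even (mx s))
noncomputable def NB (n k : ℕ) := N n (fun s => s.card = k ∧ ¬ Fix s)

lemma M_rec (n k : ℕ) : M (n+1) k = M n k + E n k := by
  unfold M E
  rw [N_congr (Q' := fun s => 1 ∈ s ∧ gtc s 1 = k ∧ Even (mx s)), N_cons,
    N_split _ _ (fun s => 1 ∈ s)]
  · congr 1
    · apply N_congr
      intro s h0 hs
      constructor
      · rintro ⟨h1, h2, h3⟩
        rw [mx_cons_of_mem h1] at h3
        simp [gtc_cons] at h2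
        exact ⟨h2, h3⟩
      · rintro ⟨h2, h3⟩
        have h1 := even_mx_mem h3
        rw [mx_cons_of_mem h1]
        simp [gtc_cons]
        exact ⟨h1, h2, h3⟩
    · apply N_congr
      intro s h0 hs
      apply and_congr_right
      intro h1
      simp [gtc_cons, gtc_one_of s h0 h1]
  · intro s _ _
    constructor
    · rintro ⟨a, b⟩; exact ⟨even_mx_mem b, a, b⟩
    · rintro ⟨_, h⟩; exact h

lemma A_rec (n k : ℕ) : A (n+1) (k+1) = A n k + E n k := by
  unfold A E
  rw [N_congr (Q' := fun s => 1 ∈ s ∧ s.card = k+1 ∧ Even (mx s)), N_cons,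
    N_split _ _ (fun s => 1 ∈ s)]
  · congr 1
    · apply N_congr
      intro s h0 hs
      constructor
      · rintro ⟨h1, h2, h3⟩
        rw [mx_cons_of_mem h1] at h3
        simp at h2
        exact ⟨h2, h3⟩
      · rintro ⟨h2, h3⟩
        have h1 := even_mx_mem h3
        rw [mx_cons_of_mem h1]
        simp
        exact ⟨h1, h2, h3⟩
    · apply N_congr
      intro s h0 hs
      simp
  · intro s _ _
    constructor
    · rintro ⟨a, b⟩; exact ⟨even_mx_mem b, a, b⟩
    · rintro ⟨_, h⟩; exact h

lemma E_eq (m k : ℕ) : E (m+k) k = NA m k := by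
  unfold E NA
  rw [N_succ]
  apply N_congr
  intro s _ _
  rw [mx_shift, Nat.even_add_one]

lemma F_rec (n k : ℕ) : F (n+1) (k+1) = F n (k+1) + D (n+1) (k+1) := by
  unfold F D
  rw [N_split _ _ (fun s => 1 ∈ s), N_cons]
  congr 1
  · apply N_congr
    intro s h0 hs
    simp only [gtc_cons, lt_irrefl, if_false, add_zero]
    apply and_congr_right
    intro h
    have := gtc_le_card s 1
    exact fix_cons_one s h0 (by omega)
  · apply N_congr
    intro s h0 hs
    apply and_congr_right
    intro h1
    rw [gtc_one_of s h0 h1]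

lemma B_rec (n k : ℕ) (hk : 0 < k) : B (n+1) (k+1) = B n k + D (n+1) (k+1) := by
  unfold B D
  rw [N_split _ _ (fun s => 1 ∈ s), N_cons]
  congr 1
  apply N_congr
  intro s h0 hs
  simp only [Multiset.card_cons, add_left_inj]
  apply and_congr_right
  intro h
  exact fix_cons_one s h0 (by omega)

lemma A_add (n k : ℕ) : A n k + NA n k = N n (fun s => s.card = k) := by
  rw [N_split n _ (fun s => Even (mx s))]
  unfold A NA
  congr 1 <;> apply N_congr <;> intro s _ _ <;> tauto

lemma B_add (n k : ℕ) : B n k + NB n k = N n (fun s => s.card = k) := by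
  rw [N_split n _ (fun s => Fix s)]
  unfold B NB
  congr 1 <;> apply N_congr <;> intro s _ _ <;> tauto

/-! The bijection between D and NB. -/

lemma split_unique {c : ℕ} {U W U' W' : Multiset ℕ} (h : U + W = U' + W')
    (hc : U.card = U'.card) (hU : ∀ x ∈ U, c ≤ x) (hU' : ∀ x ∈ U', c ≤ x)
    (hW : ∀ x ∈ W, x ≤ c) (hW' : ∀ x ∈ W', x ≤ c) : U = U' := by
  have main : ∀ x, c < x → U.count x = U'.count x := by
    intro x hx
    have := congrArg (Multiset.count x) h
    simp only [Multiset.count_add] at this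
    rw [Multiset.count_eq_zero_of_notMem (s := W) (fun h => by have := hW x h; omega),
      Multiset.count_eq_zero_of_notMem (s := W') (fun h => by have := hW' x h; omega)] at this
    omega
  have hf : U.filter (fun x => c < x) = U'.filter (fun x => c < x) := by
    ext x
    simp only [Multiset.count_filter]
    split_ifs with hx
    · exact main x hx
    · rfl
  have dec : ∀ V : Multiset ℕ, (∀ x ∈ V, c ≤ x) →
      V = V.filter (fun x => c < x) + Multiset.replicate (V.card - gtc V c) c := by
    intro V hV
    have h1 := Multiset.filter_add_not (fun x => c < x) V
    have h2 : V.filter (fun x => ¬ c < x) =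
        Multiset.replicate (V.filter (fun x => ¬ c < x)).card c := by
      rw [Multiset.eq_replicate]
      refine ⟨rfl, fun b hb => ?_⟩
      rw [Multiset.mem_filter] at hb
      have := hV b hb.1
      omega
    have h3 := congrArg Multiset.card h1
    rw [Multiset.card_add] at h3
    have h4 : (V.filter (fun x => ¬ c < x)).card = V.card - gtc V c := by
      unfold gtc; omega
    rw [h4] at h2
    rw [← h2, h1]
  rw [dec U hU, dec U' hU', hf, hc]
  unfold gtc
  rw [hf]

lemma split_exists {c j : ℕ} (S : Multiset ℕ) (h1 : gtc S c ≤ j)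
    (h2 : j + 1 ≤ gtc S c + S.count c) : ∃ U W : Multiset ℕ, S = U + c ::ₘ W ∧ U.card = j ∧
      (∀ x ∈ U, c ≤ x) ∧ (∀ x ∈ W, x ≤ c) := by
  refine ⟨S.filter (fun x => c < x) + Multiset.replicate (j - gtc S c) c,
    S.filter (fun x => x < c) + Multiset.replicate (S.count c - (j - gtc S c) - 1) c,
    ?_, ?_, ?_, ?_⟩
  · ext x
    simp only [Multiset.count_add, Multiset.count_cons, Multiset.count_filter,
      Multiset.count_replicate]
    rcases lt_trichotomy x c with h | h | h
    · simp [h, h.ne, h.ne', h.not_gt]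
    · subst h; simp; omega
    · simp [h, h.ne, h.ne', h.not_gt]
  · rw [Multiset.card_add, Multiset.card_replicate]
    unfold gtc at *; omega
  · intro x hx
    rw [Multiset.mem_add, Multiset.mem_filter, Multiset.mem_replicate] at hx
    omega
  · intro x hx
    rw [Multiset.mem_add, Multiset.mem_filter, Multiset.mem_replicate] at hx
    omega

lemma gtc_succ (S : Multiset ℕ) (j : ℕ) : gtc S j = gtc S (j+1) + S.count (j+1) := by
  induction S using Multiset.induction with
  | empty => simp [gtc]
  | cons a s ih =>
    rw [gtc_cons, gtc_cons, Multiset.count_cons, ih]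
    split_ifs <;> omega

/-- The map with parameter `j`. -/
noncomputable def g (j : ℕ) (s : Multiset ℕ) : Multiset ℕ :=
  s.filter (fun x => j < x) + (j+1) ::ₘ (s.filter (fun x => ¬ j < x)).map Nat.succ

lemma g_fix {j : ℕ} {s : Multiset ℕ} (h : gtc s j = j) :
    gtc (g j s) (j+1) ≤ j ∧ j < gtc (g j s) j := by
  unfold g
  rw [gtc_add, gtc_add, gtc_cons, gtc_cons,
    gtc_eq_zero (s := (Multiset.map Nat.succ _)) (j := j+1),
    gtc_eq_card (s := s.filter (fun x => j < x)) (j := j)]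
  · have : gtc (s.filter (fun x => j < x)) (j+1) ≤ _ := gtc_le_card _ _
    unfold gtc at *
    simp only [lt_irrefl, if_false, Nat.lt_succ_self, if_true]; omega
  · intro x hx
    exact (Multiset.mem_filter.1 hx).2
  · intro x hx
    obtain ⟨y, hy, rfl⟩ := Multiset.mem_map.1 hx
    have := (Multiset.mem_filter.1 hy).2
    simp; omega

lemma fix_unique {s : Multiset ℕ} {i j : ℕ} (h1 : gtc s (j+1) ≤ j) (h2 : j < gtc s j)
    (h3 : gtc s (i+1) ≤ i) (h4 : i < gtc s i) : i = j := by
  rcases lt_trichotomy i j with h | h | h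
  · have := gtc_anti s (show i+1 ≤ j from h); omega
  · exact h
  · have := gtc_anti s (show j+1 ≤ i from h); omega

lemma g_inj {i j : ℕ} {s t : Multiset ℕ} (hs : gtc s i = i) (ht : gtc t j = j)
    (h : g i s = g j t) : s = t := by
  have a := g_fix hs
  have b := g_fix ht
  rw [h] at a
  obtain rfl := fix_unique b.1 b.2 a.1 a.2
  have hU : s.filter (fun x => i < x) = t.filter (fun x => i < x) := by
    unfold g at h
    refine split_unique (c := i+1) h ?_ ?_ ?_ ?_ ?_
    · unfold gtc at hs ht; omega
    · intro x hx; exact (Multiset.mem_filter.1 hx).2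
    · intro x hx; exact (Multiset.mem_filter.1 hx).2
    all_goals
      intro x hx
      rcases Multiset.mem_cons.1 hx with rfl | hx
      · exact le_rfl
      obtain ⟨y, hy, rfl⟩ := Multiset.mem_map.1 hx
      have := (Multiset.mem_filter.1 hy).2
      simp; omega
  have hL : s.filter (fun x => ¬ i < x) = t.filter (fun x => ¬ i < x) := by
    unfold g at h
    rw [hU] at h
    have h := add_left_cancel h
    rw [Multiset.cons_inj_right] at h
    exact Multiset.map_injective Nat.succ_injective h
  rw [← Multiset.filter_add_not (fun x => i < x) s, hU, hL, Multiset.filter_add_not]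

lemma g_card (j : ℕ) (s : Multiset ℕ) : (g j s).card = s.card + 1 := by
  conv_rhs => rw [← Multiset.filter_add_not (fun x => j < x) s]
  simp only [g, Multiset.card_add, Multiset.card_cons, Multiset.card_map]
  omega

lemma g_sum {j : ℕ} {s : Multiset ℕ} (h : gtc s j = j) : (g j s).sum = s.sum + s.card + 1 := by
  have h2 := Multiset.filter_add_not (fun x => j < x) s
  have h3 := congrArg Multiset.sum h2
  have h4 := congrArg Multiset.card h2
  unfold g
  rw [Multiset.sum_add, Multiset.sum_cons, sum_map_succ]
  rw [Multiset.sum_add] at h3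
  rw [Multiset.card_add] at h4
  unfold gtc at h
  omega

lemma D_eq (m k : ℕ) (hk : 0 < k) : D (m+k+1) (k+1) = NB m k := by
  symm
  unfold D NB N
  have ch : ∀ s : Multiset ℕ, ∃ j, ¬ Fix s → gtc s j = j := by
    intro s
    by_cases h : Fix s
    · exact ⟨0, fun h' => absurd h h'⟩
    · obtain ⟨j, hj⟩ := (not_fix_iff s).1 h
      exact ⟨j, fun _ => hj⟩
  choose J hJ using ch
  refine Set.ncard_congr (fun s _ => g (J s) s) ?_ ?_ ?_
  · rintro s ⟨h0, hs, hc, hf⟩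
    have hj := hJ s hf
    have hjpos : J s ≠ 0 := by
      intro h
      rw [h, gtc_zero_of s h0] at hj
      omega
    have hx : ∀ x ∈ g (J s) s, 1 < x := by
      intro x hx
      unfold g at hx
      rw [Multiset.mem_add, Multiset.mem_cons, Multiset.mem_map] at hx
      rcases hx with hx | rfl | ⟨y, hy, rfl⟩
      · have := (Multiset.mem_filter.1 hx).2; omega
      · omega
      · have hy' : y ≠ 0 := fun h => h0 (h ▸ (Multiset.mem_filter.1 hy).1)
        simp; omega
    refine ⟨fun h => ?_, ?_, fun h => ?_, ?_, ?_⟩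
    · have := hx 0 h; omega
    · rw [g_sum hj]; omega
    · have := hx 1 h; omega
    · rw [g_card, hc]
    · exact ⟨J s, g_fix hj⟩
  · rintro s t ⟨_, _, _, hs⟩ ⟨_, _, _, ht⟩ h
    exact g_inj (hJ s hs) (hJ t ht) h
  · rintro b ⟨h0, hs, h1, hc, j, hj1, hj2⟩
    obtain ⟨U, W, hb, hUc, hU, hW⟩ := split_exists (c := j+1) (j := j) b hj1 (by
      have := gtc_succ b j; omega)
    have hmemW : ∀ x ∈ W, 2 ≤ x := by
      intro x hx
      have hxb : x ∈ b := by rw [hb]; simp [hx]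
      have : x ≠ 0 := fun h => h0 (h ▸ hxb)
      have : x ≠ 1 := fun h => h1 (h ▸ hxb)
      omega
    have f1 : (U + W.map Nat.pred).filter (fun x => j < x) = U := by
      rw [Multiset.filter_add, (Multiset.filter_eq_self (s := U) (p := fun x => j < x)).2 hU, Multiset.filter_eq_nil.2, add_zero]
      intro x hx
      obtain ⟨y, hy, rfl⟩ := Multiset.mem_map.1 hx
      have := hW y hy
      simp; omega
    have f2 : (U + W.map Nat.pred).filter (fun x => ¬ j < x) = W.map Nat.pred := by
      rw [Multiset.filter_add, Multiset.filter_eq_nil.2, zero_add, Multiset.filter_eq_self.2]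
      · intro x hx
        obtain ⟨y, hy, rfl⟩ := Multiset.mem_map.1 hx
        have := hW y hy
        simp; omega
      · intro x hx
        have := hU x hx
        omega
    have hWW : (W.map Nat.pred).map Nat.succ = W := by
      rw [Multiset.map_map]
      conv_rhs => rw [← Multiset.map_id W]
      apply Multiset.map_congr rfl
      intro x hx
      have := hmemW x hx
      simp; omega
    have hgj : gtc (U + W.map Nat.pred) j = j := by
      unfold gtc; rw [f1, hUc]
    have hgb : g j (U + W.map Nat.pred) = b := by
      unfold g; rw [f1, f2, hWW, hb]
    have hnf : ¬ Fix (U + W.map Nat.pred) := (not_fix_iff _).2 ⟨j, hgj⟩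
    have hcard := g_card j (U + W.map Nat.pred)
    have hsum := g_sum hgj
    rw [hgb] at hcard hsum
    have hJj : J (U + W.map Nat.pred) = j := by
      have e := hJ _ hnf
      rcases lt_trichotomy (J (U + W.map Nat.pred)) j with h | h | h
      · have := gtc_anti (U + W.map Nat.pred) h.le; omega
      · exact h
      · have := gtc_anti (U + W.map Nat.pred) h.le; omega
    refine ⟨U + W.map Nat.pred, ⟨?_, by omega, by omega, hnf⟩, ?_⟩
    · intro h
      rcases Multiset.mem_add.1 h with h | h
      · have := hU 0 h; omega
      · obtain ⟨y, hy, hy'⟩ := Multiset.mem_map.1 h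
        have := hmemW y hy
        simp at hy'; omega
    · show g (J _) _ = b
      rw [hJj, hgb]

lemma card_le_sum {s : Multiset ℕ} (h : 0 ∉ s) : s.card ≤ s.sum := by
  induction s using Multiset.induction with
  | empty => simp
  | cons a s ih =>
    simp only [Multiset.mem_cons, not_or] at h
    have := ih h.2
    simp; omega

lemma AB_small {n k : ℕ} (h : n < k) : A n k = 0 ∧ B n k = 0 := by
  constructor <;> apply N_zero <;> rintro s h0 hs ⟨hc, _⟩ <;> have := card_le_sum h0 <;> omega

lemma ED_small {n k : ℕ} (h : n < k) : E n k = 0 ∧ D (n+1) (k+1) = 0 := by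
  constructor <;> apply N_zero <;> rintro s h0 hs ⟨_, hc, _⟩ <;> have := card_le_sum h0 <;> omega

lemma A_zero (n : ℕ) : A n 0 = 0 := by
  apply N_zero
  rintro s _ _ ⟨hc, he⟩
  have := even_mx_mem he
  rw [Multiset.card_eq_zero.1 hc] at this
  simp at this

lemma B_zero (n : ℕ) : B n 0 = 0 := by
  apply N_zero
  rintro s _ _ ⟨hc, j, _, h⟩
  have := gtc_le_card s j
  omega

lemma B_one (m : ℕ) : B (m+1) 1 = NB m 0 := by
  unfold B NB N
  refine Set.ncard_congr (fun _ _ => (0 : Multiset ℕ)) ?_ ?_ ?_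
  · rintro s ⟨h0, hs, hc, j, h1, h2⟩
    obtain ⟨a, rfl⟩ := Multiset.card_eq_one.1 hc
    have := gtc_le_card {a} j
    simp only [Multiset.card_singleton] at this
    have hj : j = 0 := by omega
    subst hj
    simp at hs
    rw [show ({a} : Multiset ℕ) = a ::ₘ 0 from rfl, gtc_cons, gtc_zero] at h1
    split_ifs at h1 with h3
    · omega
    · refine ⟨by simp, by simp; omega, by simp, (not_fix_iff _).2 ⟨0, by simp [gtc]⟩⟩
  · rintro s t ⟨_, hs, hc, _⟩ ⟨_, ht, hc', _⟩ _
    obtain ⟨a, rfl⟩ := Multiset.card_eq_one.1 hc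
    obtain ⟨b, rfl⟩ := Multiset.card_eq_one.1 hc'
    simp at hs ht
    rw [hs, ht]
  · rintro b ⟨_, hs, hc, _⟩
    obtain rfl := Multiset.card_eq_zero.1 hc
    simp at hs
    subst hs
    exact ⟨{1}, ⟨by simp, by simp, by simp, 0, by simp [gtc], by
      rw [gtc_eq_card] <;> simp⟩, rfl⟩

lemma A_eq_B (n : ℕ) : ∀ k, A n k = B n k := by
  induction n using Nat.strong_induction_on with
  | _ n ih =>
    intro k
    rcases k with _ | k
    · rw [A_zero, B_zero]
    rcases lt_or_ge n (k+1) with h | h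
    · rw [(AB_small h).1, (AB_small h).2]
    obtain ⟨m, rfl⟩ : ∃ m, n = m + k + 1 := ⟨n - (k+1), by omega⟩
    have e1 := A_add m k
    have e2 := B_add m k
    have e3 := ih m (by omega) k
    rw [A_rec, E_eq, ih (m+k) (by omega) k]
    rcases Nat.eq_zero_or_pos k with rfl | hk
    · have e4 := B_one m
      rw [B_zero]
      simp only [add_zero, zero_add] at *
      omega
    · rw [B_rec _ _ hk, D_eq _ _ hk]
      omega

lemma E_eq_D (n k : ℕ) (hk : 0 < k) : E n k = D (n+1) (k+1) := by
  have h1 := A_rec n k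
  have h2 := B_rec n k hk
  have h3 := A_eq_B (n+1) (k+1)
  have h4 := A_eq_B n k
  omega

lemma M_eq_F (n k : ℕ) (hk : 0 < k) : M n k = F n (k+1) := by
  induction n with
  | zero =>
    have aux : ∀ s : Multiset ℕ, 0 ∉ s → s.sum = 0 → gtc s 1 = 0 := by
      intro s h0 hs
      have := card_le_sum h0
      have := gtc_le_card s 1
      omega
    unfold M F
    rw [N_zero, N_zero]
    · rintro s h0 hs ⟨h, _⟩; have := aux s h0 hs; omega
    · rintro s h0 hs ⟨h, _⟩; have := aux s h0 hs; omega
  | succ n ih => rw [M_rec, F_rec, ih, E_eq_D n k hk]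

/-! Transfer of the sorted-list fixed point definition. -/

lemma sorted_le_iff (l : List ℕ) (hl : l.Pairwise (· ≥ ·)) (i v : ℕ) (hv : 0 < v) :
    v ≤ l.getD i 0 ↔ i < gtc (l : Multiset ℕ) (v - 1) := by
  induction l generalizing i with
  | nil => simp [gtc]; omega
  | cons a l ih =>
    rw [List.pairwise_cons] at hl
    rw [← Multiset.cons_coe, gtc_cons]
    rcases i with _ | i
    · simp only [List.getD_cons_zero]
      split_ifs with h
      · constructor <;> intro <;> omega
      · rw [gtc_eq_zero]
        · omega
        · intro x hx
          have := hl.1 x (by simpa using hx)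
          omega
    · simp only [List.getD_cons_succ]
      rw [ih hl.2]
      split_ifs with h
      · omega
      · rw [gtc_eq_zero]
        · omega
        · intro x hx
          have := hl.1 x (by simpa using hx)
          omega

lemma hasFixedPoint_iff {n : ℕ} (p : n.Partition) : hasFixedPoint p ↔ Fix p.parts := by
  have hl : (sortedParts p).Pairwise (· ≥ ·) := Multiset.pairwise_sort _ _
  have he : ((sortedParts p : List ℕ) : Multiset ℕ) = p.parts := Multiset.sort_eq _ _
  have key := sorted_le_iff (sortedParts p) hl
  rw [he] at key
  have hlen : (sortedParts p).length = p.parts.card := by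
    rw [← he]; simp
  unfold hasFixedPoint Fix
  constructor
  · rintro ⟨i, h0, h1, h2⟩
    obtain ⟨j, rfl⟩ : ∃ j, i = j + 1 := ⟨i - 1, by omega⟩
    have a := key j (j+1) (by omega)
    have b := key j (j+2) (by omega)
    simp only [Nat.add_sub_cancel, show j + 2 - 1 = j + 1 from rfl] at a b h2
    exact ⟨j, by omega, by omega⟩
  · rintro ⟨j, h1, h2⟩
    have a := key j (j+1) (by omega)
    have b := key j (j+2) (by omega)
    have c := gtc_le_card p.parts j
    simp only [Nat.add_sub_cancel, show j + 2 - 1 = j + 1 from rfl] at a b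
    refine ⟨j+1, by omega, by omega, ?_⟩
    simp only [Nat.add_sub_cancel]
    omega

end EvenMex

theorem even_mex_eq_fixed_point (n k : ℕ) (hn : 0 < n) (hk : 0 < k) :
    {p : Nat.Partition n | Even (mex p) ∧ betaStat p = k}.ncard = {p : Nat.Partition n | hasFixedPoint p ∧ betaStat p = k + 1}.ncard := by
  have h := EvenMex.M_eq_F n k hk
  unfold EvenMex.M EvenMex.F at h
  rw [← EvenMex.N_partition, ← EvenMex.N_partition] at h
  have e1 : {p : Nat.Partition n | Even (mex p) ∧ betaStat p = k} =
      {p : Nat.Partition n | EvenMex.gtc p.parts 1 = k ∧ Even (EvenMex.mx p.parts)} := by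
    ext p
    simp only [Set.mem_ofPred_eq, mex, betaStat, EvenMex.mx, EvenMex.gtc]
    rw [and_comm]
  have e2 : {p : Nat.Partition n | hasFixedPoint p ∧ betaStat p = k + 1} =
      {p : Nat.Partition n | EvenMex.gtc p.parts 1 = k + 1 ∧ EvenMex.Fix p.parts} := by
    ext p
    simp only [Set.mem_ofPred_eq, EvenMex.hasFixedPoint_iff, betaStat, EvenMex.gtc]
    rw [and_comm]
  rw [e1, e2]
  exact h
end

section
/- For every positive integer n, the number of partitions of n with even mex equals the number of partitions of n with a fixed point. -/
open scoped Classical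

/-- Multisets of positive integers with sum `n`. -/
def PS (n : ℕ) : Set (Multiset ℕ) := {s | s.sum = n ∧ 0 ∉ s}

/-- The run of consecutive parts `m+1, m+2, …` of `s` has length exactly `j`. -/
def RunLen (m j : ℕ) (s : Multiset ℕ) : Prop :=
  (∀ i, m < i → i ≤ m + j → i ∈ s) ∧ m + j + 1 ∉ s

/-- The run of consecutive parts above `m` has odd length. -/
def OddRun (m : ℕ) (s : Multiset ℕ) : Prop := ∃ j, Odd j ∧ RunLen m j s

/-- The `i`-th largest part is `i + m` for some `i ≥ 1`; here `v = i + m`. -/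
def FPAt (m v : ℕ) (s : Multiset ℕ) : Prop :=
  (s.filter (fun x => v < x)).card + m < v ∧ v ≤ (s.filter (fun x => v ≤ x)).card + m

/-- There is an `m`-shifted fixed point. -/
def FP (m : ℕ) (s : Multiset ℕ) : Prop := ∃ v, FPAt m v s

lemma parts_injective (n : ℕ) : Function.Injective (fun p : Nat.Partition n => p.parts) :=
  fun p q h => Nat.Partition.ext h

lemma PS_eq_range (n : ℕ) : PS n = Set.range (fun p : Nat.Partition n => p.parts) := by
  ext s
  constructor
  · rintro ⟨h1, h2⟩
    refine ⟨⟨s, ?_, h1⟩, rfl⟩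
    intro i hi
    rcases Nat.eq_zero_or_pos i with h | h
    · subst h; exact absurd hi h2
    · exact h
  · rintro ⟨p, rfl⟩
    exact ⟨p.parts_sum, fun h => absurd (p.parts_pos h) (lt_irrefl 0)⟩

lemma PS_finite (n : ℕ) : (PS n).Finite := by
  rw [PS_eq_range]; exact Set.finite_range _

lemma ncard_transfer (n : ℕ) (P : Nat.Partition n → Prop) (Q : Multiset ℕ → Prop)
    (h : ∀ p, P p ↔ Q p.parts) : {p | P p}.ncard = {s | s ∈ PS n ∧ Q s}.ncard := by
  rw [← Set.ncard_image_of_injective _ (parts_injective n)]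
  congr 1
  ext s
  rw [PS_eq_range]
  constructor
  · rintro ⟨p, hp, rfl⟩
    exact ⟨⟨p, rfl⟩, (h p).1 hp⟩
  · rintro ⟨⟨p, rfl⟩, hq⟩
    exact ⟨p, (h p).2 hq, rfl⟩

lemma compl_card (n : ℕ) (Q : Multiset ℕ → Prop) :
    {s | s ∈ PS n ∧ Q s}.ncard + {s | s ∈ PS n ∧ ¬ Q s}.ncard = (PS n).ncard := by
  have h := Set.ncard_inter_add_ncard_diff_eq_ncard (PS n) {s | Q s} (PS_finite n)
  exact h

lemma exists_run (m : ℕ) (s : Multiset ℕ) : ∃ j, RunLen m j s := by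
  have hex : ∃ j, m + j + 1 ∉ s := by
    refine ⟨s.sum, fun h => ?_⟩
    have := Multiset.single_le_sum (fun x _ => Nat.zero_le x) _ h
    omega
  refine ⟨Nat.find hex, ?_, Nat.find_spec hex⟩
  intro i h1 h2
  have := Nat.find_min hex (m := i - m - 1) (by omega)
  rw [not_not] at this
  rwa [show m + (i - m - 1) + 1 = i by omega] at this

lemma run_unique {m j k : ℕ} {s : Multiset ℕ} (hj : RunLen m j s) (hk : RunLen m k s) : j = k := by
  rcases lt_trichotomy j k with h | h | h
  · exact absurd (hk.1 (m + j + 1) (by omega) (by omega)) hj.2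
  · exact h
  · exact absurd (hj.1 (m + k + 1) (by omega) (by omega)) hk.2

lemma not_oddRun {m : ℕ} {s : Multiset ℕ} : ¬ OddRun m s ↔ ∃ j, Even j ∧ RunLen m j s := by
  obtain ⟨k, hk⟩ := exists_run m s
  constructor
  · intro h
    refine ⟨k, ?_, hk⟩
    by_contra h'
    exact h ⟨k, Nat.not_even_iff_odd.1 h', hk⟩
  · rintro ⟨j, hj, hr⟩ ⟨i, hi, hr'⟩
    rw [run_unique hr' hr] at hi
    exact (Nat.not_even_iff_odd.2 hi) hj

lemma run_cons (m j : ℕ) (t : Multiset ℕ) : RunLen m (j + 1) ((m + 1) ::ₘ t) ↔ RunLen (m + 1) j t := by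
  unfold RunLen
  simp only [Multiset.mem_cons]
  constructor
  · rintro ⟨h1, h2⟩
    refine ⟨fun i hi hi' => ?_, fun h => h2 (Or.inr ?_)⟩
    · rcases h1 i (by omega) (by omega) with h | h
      · omega
      · exact h
    · rwa [show m + (j + 1) + 1 = m + 1 + j + 1 by omega]
  · rintro ⟨h1, h2⟩
    refine ⟨fun i hi hi' => ?_, ?_⟩
    · by_cases h : i = m + 1
      · exact Or.inl h
      · exact Or.inr (h1 i (by omega) (by omega))
    · rintro (h | h)
      · omega
      · rw [show m + (j + 1) + 1 = m + 1 + j + 1 by omega] at h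
        exact h2 h

lemma mex_step (m n : ℕ) :
    {t | t ∈ PS n ∧ ¬ OddRun (m + 1) t}.ncard = {s | s ∈ PS (n + (m + 1)) ∧ OddRun m s}.ncard := by
  refine Set.ncard_congr (fun t _ => (m + 1) ::ₘ t) ?_ ?_ ?_
  · rintro t ⟨⟨h1, h2⟩, h3⟩
    obtain ⟨j, hj, hr⟩ := not_oddRun.1 h3
    refine ⟨⟨by simp [h1]; omega, by simp [h2]⟩, j + 1, hj.add_one, (run_cons m j t).2 hr⟩
  · intro a b _ _ h
    exact (Multiset.cons_inj_right _).1 h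
  · rintro s ⟨⟨h1, h2⟩, j, hj, hr⟩
    have hmem : m + 1 ∈ s := hr.1 _ (by omega) (by have := hj.pos; omega)
    obtain ⟨t, rfl⟩ := Multiset.exists_cons_of_mem hmem
    simp only [Multiset.sum_cons, Multiset.mem_cons, not_or] at h1 h2
    refine ⟨t, ⟨⟨by omega, h2.2⟩, not_oddRun.2 ⟨j - 1, hj.tsub_odd odd_one, ?_⟩⟩, rfl⟩
    obtain ⟨k, rfl⟩ : ∃ k, j = k + 1 := ⟨j - 1, by have := hj.pos; omega⟩
    exact (run_cons m k t).1 hr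

lemma filter_card_anti (s : Multiset ℕ) {v w : ℕ} (h : v ≤ w) :
    (s.filter (fun x => w < x)).card ≤ (s.filter (fun x => v < x)).card :=
  Multiset.card_le_card (Multiset.monotone_filter_right s (fun x hx => lt_of_le_of_lt h hx))

lemma filter_card_le (s : Multiset ℕ) {v w : ℕ} (h : v < w) :
    (s.filter (fun x => w ≤ x)).card ≤ (s.filter (fun x => v < x)).card :=
  Multiset.card_le_card (Multiset.monotone_filter_right s (fun x hx => lt_of_lt_of_le h hx))

lemma FPAt_unique {m v w : ℕ} {s : Multiset ℕ} (hv : FPAt m v s) (hw : FPAt m w s) : v = w := by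
  obtain ⟨a, b⟩ := hv
  obtain ⟨c, d⟩ := hw
  rcases lt_trichotomy v w with h | h | h
  · have := filter_card_le s h; omega
  · exact h
  · have := filter_card_le s h; omega

lemma not_FP {m : ℕ} {s : Multiset ℕ} :
    ¬ FP (m + 1) s ↔ ∃ v, (s.filter (fun x => v < x)).card + (m + 1) = v := by
  constructor
  · intro h
    have hex : ∃ v, (s.filter (fun x => v < x)).card + (m + 1) ≤ v :=
      ⟨s.card + (m + 1), by
        have := Multiset.card_le_card (Multiset.filter_le (fun x => s.card + (m + 1) < x) s)
        omega⟩
    refine ⟨Nat.find hex, ?_⟩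
    have h1 := Nat.find_spec hex
    have h2 := Nat.find_min hex (m := Nat.find hex - 1) (by omega)
    generalize Nat.find hex = v at h1 h2
    by_contra h3
    apply h
    refine ⟨v, by omega, ?_⟩
    have : (s.filter (fun x => v - 1 < x)) = s.filter (fun x => v ≤ x) :=
      Multiset.filter_congr (fun x _ => by omega)
    rw [this] at h2
    omega
  · rintro ⟨v, hv⟩ ⟨w, h1, h2⟩
    rcases lt_or_ge v w with h | h
    · have := filter_card_le s h; omega
    · have := filter_card_anti s h; omega

/-- Pieces: `A` has all entries `≥ v`, `B` has all entries `≤ v`. -/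
lemma FPAt_mk {m v : ℕ} {A B : Multiset ℕ} (hA : ∀ x ∈ A, v ≤ x) (hB : ∀ x ∈ B, x ≤ v)
    (hc : A.card + (m + 1) = v) : FPAt m v (v ::ₘ (A + B)) := by
  have e1 : B.filter (fun x => v < x) = 0 :=
    Multiset.filter_eq_nil.2 (fun x hx => not_lt.2 (hB x hx))
  have e2 : A.filter (fun x => v ≤ x) = A := Multiset.filter_eq_self.2 hA
  have e3 := Multiset.card_le_card (Multiset.filter_le (fun x => v < x) A)
  constructor
  · simp [e1]; omega
  · simp [e2]; omega

lemma pieces_unique {v : ℕ} {A B A' B' : Multiset ℕ} (hA : ∀ x ∈ A, v ≤ x) (hB : ∀ x ∈ B, x ≤ v)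
    (hA' : ∀ x ∈ A', v ≤ x) (hB' : ∀ x ∈ B', x ≤ v) (hc : A.card = A'.card)
    (h : A + B = A' + B') : A = A' ∧ B = B' := by
  have key : ∀ A B : Multiset ℕ, (∀ x ∈ A, v ≤ x) → (∀ x ∈ B, x ≤ v) →
      A = (A + B).filter (fun x => v < x) +
        Multiset.replicate (A.card - ((A + B).filter (fun x => v < x)).card) v := by
    intro A B hA hB
    have e1 : B.filter (fun x => v < x) = 0 :=
      Multiset.filter_eq_nil.2 (fun x hx => not_lt.2 (hB x hx))
    rw [Multiset.filter_add, e1, add_zero]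
    have e2 := Multiset.filter_add_not (fun x => v < x) A
    have e3 : A.filter (fun x => ¬ v < x) =
        Multiset.replicate (A.filter (fun x => ¬ v < x)).card v := by
      rw [Multiset.eq_replicate_card]
      intro b hb
      rw [Multiset.mem_filter] at hb
      have := hA b hb.1
      omega
    have e4 := congrArg Multiset.card e2
    rw [Multiset.card_add] at e4
    rw [show A.card - (A.filter (fun x => v < x)).card = (A.filter (fun x => ¬ v < x)).card by omega,
      ← e3, e2]
  have hAA : A = A' := by
    rw [key A B hA hB, key A' B' hA' hB', h, hc]
  subst hAA
  exact ⟨rfl, add_left_cancel h⟩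

lemma pieces_exist {m v : ℕ} {s : Multiset ℕ} (h : FPAt m v s) :
    ∃ A B : Multiset ℕ, (∀ x ∈ A, v ≤ x) ∧ (∀ x ∈ B, x ≤ v) ∧ A.card + (m + 1) = v ∧
      s = v ::ₘ (A + B) := by
  obtain ⟨h1, h2⟩ := h
  have d1 := Multiset.filter_add_not (fun x => v < x) s
  have d2 := Multiset.filter_add_not (fun x => v ≤ x) s
  have d3 := Multiset.filter_add_not (fun x => v < x) (s.filter (fun x => v ≤ x))
  have e1 : (s.filter (fun x => v ≤ x)).filter (fun x => v < x) = s.filter (fun x => v < x) := by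
    rw [Multiset.filter_filter]
    exact Multiset.filter_congr (fun x _ => by omega)
  rw [e1] at d3
  set C := (s.filter (fun x => v ≤ x)).filter (fun x => ¬ v < x) with hC
  have hCr : C = Multiset.replicate C.card v := by
    rw [Multiset.eq_replicate_card]
    intro b hb
    rw [hC, Multiset.mem_filter, Multiset.mem_filter] at hb
    omega
  have e4 := congrArg Multiset.card d3
  rw [Multiset.card_add] at e4
  obtain ⟨a, ha⟩ : ∃ a, a = v - (m + 1) - (s.filter (fun x => v < x)).card := ⟨_, rfl⟩
  refine ⟨s.filter (fun x => v < x) + Multiset.replicate a v,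
    Multiset.replicate (C.card - 1 - a) v + s.filter (fun x => ¬ v ≤ x), ?_, ?_, ?_, ?_⟩
  · intro x hx
    rw [Multiset.mem_add, Multiset.mem_filter, Multiset.mem_replicate] at hx
    omega
  · intro x hx
    rw [Multiset.mem_add, Multiset.mem_filter, Multiset.mem_replicate] at hx
    omega
  · rw [Multiset.card_add, Multiset.card_replicate]; omega
  · have hs : Multiset.replicate C.card v =
        v ::ₘ (Multiset.replicate a v + Multiset.replicate (C.card - 1 - a) v) := by
      rw [← Multiset.replicate_add, ← Multiset.replicate_succ]
      congr 1
      omega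
    conv_lhs => rw [← d2, ← d3, hCr, hs]
    simp only [← Multiset.singleton_add]
    abel

lemma map_pred_add (A : Multiset ℕ) (h : ∀ x ∈ A, 0 < x) :
    (A.map (fun x => x - 1)).sum + A.card = A.sum := by
  induction A using Multiset.induction_on with
  | empty => simp
  | cons a A ih =>
    have h1 := ih (fun x hx => h x (Multiset.mem_cons_of_mem hx))
    have h2 := h a (Multiset.mem_cons_self a A)
    simp only [Multiset.map_cons, Multiset.sum_cons, Multiset.card_cons]
    omega

lemma map_succ_pred (A : Multiset ℕ) (h : ∀ x ∈ A, 0 < x) :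
    (A.map (fun x => x - 1)).map (fun x => x + 1) = A := by
  rw [Multiset.map_map]
  conv_rhs => rw [← Multiset.map_id A]
  refine Multiset.map_congr rfl (fun x hx => ?_)
  have := h x hx
  simp only [Function.comp, id]
  omega

/-- The inverse map of the bijection. -/
def back (v : ℕ) (t : Multiset ℕ) : Multiset ℕ :=
  v ::ₘ ((t.filter (fun x => v < x)).map (fun x => x - 1) + t.filter (fun x => ¬ v < x))

lemma back_A (v : ℕ) (t : Multiset ℕ) :
    ∀ x ∈ (t.filter (fun x => v < x)).map (fun x => x - 1), v ≤ x := by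
  intro x hx
  rw [Multiset.mem_map] at hx
  obtain ⟨y, hy, rfl⟩ := hx
  rw [Multiset.mem_filter] at hy
  omega

lemma back_B (v : ℕ) (t : Multiset ℕ) : ∀ x ∈ t.filter (fun x => ¬ v < x), x ≤ v := by
  intro x hx
  rw [Multiset.mem_filter] at hx
  omega

lemma back_FP {m v : ℕ} {t : Multiset ℕ} (hv : (t.filter (fun x => v < x)).card + (m + 1) = v) :
    FPAt m v (back v t) :=
  FPAt_mk (back_A v t) (back_B v t) (by rw [Multiset.card_map]; exact hv)

lemma fp_step (m n : ℕ) :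
    {t | t ∈ PS n ∧ ¬ FP (m + 1) t}.ncard = {s | s ∈ PS (n + (m + 1)) ∧ FP m s}.ncard := by
  have pos : ∀ (v : ℕ) (t : Multiset ℕ), ∀ x ∈ t.filter (fun x => v < x), 0 < x := by
    intro v t x hx
    rw [Multiset.mem_filter] at hx
    omega
  refine Set.ncard_congr (fun t ht => back (not_FP.1 ht.2).choose t) ?_ ?_ ?_
  · intro t ht
    have hv := (not_FP.1 ht.2).choose_spec
    generalize (not_FP.1 ht.2).choose = v at hv
    obtain ⟨⟨h1, h2⟩, -⟩ := ht
    refine ⟨⟨?_, ?_⟩, v, back_FP hv⟩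
    · have e1 := map_pred_add _ (pos v t)
      have e2 := congrArg Multiset.sum (Multiset.filter_add_not (fun x => v < x) t)
      rw [Multiset.sum_add] at e2
      simp only [back, Multiset.sum_cons, Multiset.sum_add]
      omega
    · intro h
      rw [back, Multiset.mem_cons, Multiset.mem_add] at h
      rcases h with h | h | h
      · omega
      · have := back_A v t 0 h; omega
      · rw [Multiset.mem_filter] at h; exact h2 h.1
  · intro a b ha hb h
    have hv := (not_FP.1 ha.2).choose_spec
    have hw := (not_FP.1 hb.2).choose_spec
    generalize (not_FP.1 ha.2).choose = v at hv h
    generalize (not_FP.1 hb.2).choose = w at hw h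
    have f1 := back_FP hv
    rw [h] at f1
    have := FPAt_unique f1 (back_FP hw)
    subst this
    have h' := (Multiset.cons_inj_right _).1 h
    obtain ⟨p1, p2⟩ := pieces_unique (back_A v a) (back_B v a) (back_A v b) (back_B v b)
      (by rw [Multiset.card_map, Multiset.card_map]; omega) h'
    have p3 := congrArg (Multiset.map (fun x => x + 1)) p1
    rw [map_succ_pred _ (pos v a), map_succ_pred _ (pos v b)] at p3
    rw [← Multiset.filter_add_not (fun x => v < x) a, p2, p3, Multiset.filter_add_not]
  · rintro s ⟨⟨h1, h2⟩, v, hv⟩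
    obtain ⟨A, B, hA, hB, hc, rfl⟩ := pieces_exist hv
    have fA : (A.map (fun x => x + 1)).filter (fun x => v < x) = A.map (fun x => x + 1) := by
      refine Multiset.filter_eq_self.2 (fun x hx => ?_)
      obtain ⟨y, hy, rfl⟩ := Multiset.mem_map.1 hx
      have := hA y hy
      omega
    have fA' : (A.map (fun x => x + 1)).filter (fun x => ¬ v < x) = 0 := by
      refine Multiset.filter_eq_nil.2 (fun x hx => ?_)
      obtain ⟨y, hy, rfl⟩ := Multiset.mem_map.1 hx
      have := hA y hy
      omega
    have fB : B.filter (fun x => v < x) = 0 :=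
      Multiset.filter_eq_nil.2 (fun x hx => not_lt.2 (hB x hx))
    have fB' : B.filter (fun x => ¬ v < x) = B :=
      Multiset.filter_eq_self.2 (fun x hx => not_lt.2 (hB x hx))
    have ft : ((A.map (fun x => x + 1) + B).filter (fun x => v < x)).card + (m + 1) = v := by
      rw [Multiset.filter_add, fA, fB, add_zero, Multiset.card_map, hc]
    have hback : back v (A.map (fun x => x + 1) + B) = v ::ₘ (A + B) := by
      unfold back
      rw [Multiset.filter_add, Multiset.filter_add, fA, fA', fB, fB', add_zero, zero_add,
        Multiset.map_map]
      congr 2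
      simp [Function.comp_def]
    have hmem : A.map (fun x => x + 1) + B ∈ {t | t ∈ PS n ∧ ¬ FP (m + 1) t} := by
      refine ⟨⟨?_, ?_⟩, not_FP.2 ⟨v, ft⟩⟩
      · simp only [Multiset.sum_cons, Multiset.sum_add] at h1
        simp only [Multiset.sum_add, Multiset.sum_map_add, Multiset.map_id', Multiset.map_const',
          Multiset.sum_replicate, smul_eq_mul, mul_one]
        omega
      · intro h
        rw [Multiset.mem_add] at h
        rcases h with h | h
        · obtain ⟨y, hy, h⟩ := Multiset.mem_map.1 h
          omega
        · exact h2 (by simp [h])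
    refine ⟨_, hmem, ?_⟩
    have hw := (not_FP.1 hmem.2).choose_spec
    generalize (not_FP.1 hmem.2).choose = w at hw
    have hwv : w = v := by
      have f1 := filter_card_anti (A.map (fun x => x + 1) + B) (v := v) (w := w)
      have f2 := filter_card_anti (A.map (fun x => x + 1) + B) (v := w) (w := v)
      omega
    simp only [hwv, hback]

lemma main_count (n : ℕ) : ∀ m,
    {s | s ∈ PS n ∧ OddRun m s}.ncard = {s | s ∈ PS n ∧ FP m s}.ncard := by
  induction n using Nat.strong_induction_on with
  | _ n ih =>
    intro m
    by_cases h : m + 1 ≤ n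
    · obtain ⟨k, rfl⟩ : ∃ k, n = k + (m + 1) := ⟨n - (m + 1), by omega⟩
      rw [← mex_step, ← fp_step]
      have h1 := compl_card k (OddRun (m + 1))
      have h2 := compl_card k (FP (m + 1))
      have h3 := ih k (by omega) (m + 1)
      omega
    · congr 1
      ext s
      constructor
      · rintro ⟨⟨h1, h2⟩, j, hj, hr⟩
        have hm := hr.1 (m + 1) (by omega) (by have := hj.pos; omega)
        have := Multiset.single_le_sum (fun x _ => Nat.zero_le x) _ hm
        omega
      · rintro ⟨⟨h1, h2⟩, v, hv⟩
        obtain ⟨A, B, hA, hB, hc, rfl⟩ := pieces_exist hv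
        simp only [Multiset.sum_cons, Multiset.sum_add] at h1
        omega

lemma mex_iff {n : ℕ} (p : n.Partition) : Even (mex p) ↔ OddRun 0 p.parts := by
  obtain ⟨j, hj⟩ := exists_run 0 p.parts
  have hm : mex p = j + 1 := by
    unfold mex
    refine IsLeast.csInf_eq ⟨⟨by omega, ?_⟩, ?_⟩
    · have := hj.2
      rwa [zero_add] at this
    · rintro x ⟨hx, hx'⟩
      by_contra hlt
      exact hx' (hj.1 x hx (by omega))
  rw [hm]
  constructor
  · intro h
    exact ⟨j, by rcases Nat.even_or_odd j with h' | h'; · exact absurd h (by simpa [Nat.even_add_one] using h')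
                 · exact h', hj⟩
  · rintro ⟨i, hi, hr⟩
    rw [run_unique hj hr]
    exact hi.add_one

lemma sorted_get (L : List ℕ) (hL : L.Pairwise (· ≥ ·)) (i : ℕ) (hi : 0 < i) :
    (i ≤ L.length ∧ L.getD (i - 1) 0 = i) ↔
      ((L.filter (fun x => i < x)).length < i ∧ i ≤ (L.filter (fun x => i ≤ x)).length) := by
  have key : ∀ (P : ℕ → Bool) (hP : ∀ x y, x ≤ y → P x → P y) (L : List ℕ),
      L.Pairwise (· ≥ ·) → ∀ k, k < (L.filter P).length ↔ ∃ h : k < L.length, P (L[k]) := by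
    intro P hP L
    induction L with
    | nil => simp
    | cons a L ih =>
      intro hL k
      rw [List.pairwise_cons] at hL
      by_cases ha : P a
      · rw [List.filter_cons_of_pos ha]
        cases k with
        | zero => simp [ha]
        | succ k => simpa using ih hL.2 k
      · rw [List.filter_cons_of_neg ha]
        have : L.filter P = [] := by
          rw [List.filter_eq_nil_iff]
          intro x hx hpx
          exact ha (hP x a (hL.1 x hx) hpx)
        rw [this]
        constructor
        · intro h; simp at h
        · rintro ⟨h, h'⟩
          exfalso
          cases k with
          | zero => exact ha h'
          | succ k =>
            simp only [List.getElem_cons_succ] at h'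
            exact ha (hP _ a (hL.1 _ (List.getElem_mem _)) h')
  have k1 := key (fun x => decide (i < x)) (by intro x y h; simp; omega) L hL (i - 1)
  have k2 := key (fun x => decide (i ≤ x)) (by intro x y h; simp; omega) L hL (i - 1)
  simp only [decide_eq_true_eq] at k1 k2
  constructor
  · rintro ⟨h1, h2⟩
    have hlt : i - 1 < L.length := by omega
    rw [List.getD_eq_getElem _ _ hlt] at h2
    constructor
    · by_contra hc
      obtain ⟨_, h⟩ := k1.1 (by omega)
      omega
    · have := k2.2 ⟨hlt, h2.ge⟩
      omega
  · rintro ⟨h1, h2⟩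
    obtain ⟨hlt, h⟩ := k2.1 (by omega)
    refine ⟨by omega, ?_⟩
    rw [List.getD_eq_getElem _ _ hlt]
    by_contra hc
    have := k1.2 ⟨hlt, by omega⟩
    omega

lemma fp_iff {n : ℕ} (p : n.Partition) : hasFixedPoint p ↔ FP 0 p.parts := by
  have hs : (sortedParts p).Pairwise (· ≥ ·) := Multiset.pairwise_sort _ _
  have hc : ((sortedParts p : List ℕ) : Multiset ℕ) = p.parts := Multiset.sort_eq _ _
  have hf : ∀ i, 0 < i → ((i ≤ (sortedParts p).length ∧ (sortedParts p).getD (i - 1) 0 = i) ↔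
      FPAt 0 i p.parts) := by
    intro i hi
    rw [sorted_get _ hs i hi, ← hc]
    unfold FPAt
    simp only [Multiset.filter_coe, Multiset.coe_card, add_zero]
  constructor
  · rintro ⟨i, hi, h⟩
    exact ⟨i, (hf i hi).1 h⟩
  · rintro ⟨i, h⟩
    have hi : 0 < i := by have := h.1; omega
    exact ⟨i, hi, (hf i hi).2 h⟩

theorem even_mex_eq_fixed_point_total (n : ℕ) (hn : 0 < n) :
    {p : Nat.Partition n | Even (mex p)}.ncard = {p : Nat.Partition n | hasFixedPoint p}.ncard := by
  rw [ncard_transfer n _ _ mex_iff, ncard_transfer n _ _ fp_iff]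
  exact main_count n 0
end
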